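/- arXiv:1611.01252 — 3 statements merged into one kernel-verified Lean document; each statement's English description precedes it below -/
import Mathlib

section
/- There is a constant C > 0 such that for every weight w on ℝ², setting W = 𝔐₂ 𝔐 w (the strong maximal operator applied to the Hardy–Littlewood maximal function of w), for every locally integrable f and every t > 0 one has w({x ∈ ℝ² : 𝔐₂ f(x) > t}) ≤ C ∫_{ℝ²} (|f|/t)(1 + log⁺(|f|/t)) W dx, where log⁺ s = max(0, log s). The constant C does not depend on w and f. -/
open MeasureTheory ENNReal

/-- The strong maximal operator of complexity `c` in `ℝ^d`, acting on `ℝ≥0∞`-valued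
functions: the supremum of averages over all axis-parallel rectangles (boxes) containing `x`
whose side lengths take at most `c` distinct values.  For `d = 2`, `strongMaximal 2 2` is
the strong maximal operator `𝔐₂` over all axis-parallel rectangles, and `strongMaximal 2 1`
is the Hardy–Littlewood maximal operator `𝔐` over axis-parallel squares. -/
noncomputable def strongMaximal (d c : ℕ) (f : (Fin d → ℝ) → ℝ≥0∞) (x : Fin d → ℝ) : ℝ≥0∞ :=
  ⨆ (a : Fin d → ℝ) (b : Fin d → ℝ) (_ : ∀ i, a i < b i)
    (_ : (Finset.image (fun i => b i - a i) Finset.univ).card ≤ c)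
    (_ : x ∈ Set.Icc a b),
      (∫⁻ y in Set.Icc a b, f y) / volume (Set.Icc a b)

/-- The Córdoba–Fefferman selection: from a finite family of rectangles `I p × J p`, processed by
decreasing side length `len`, one extracts a subfamily whose bases `I p` have disjoint major
subsets along each slice, and whose bases cover half of every base of the family. -/
theorem exists_sparse_subfamily {ι : Type*} [DecidableEq ι] (I J : ι → Set ℝ) (len : ι → ℝ)
    (hI : ∀ p, MeasurableSet (I p)) (F : Finset ι)
    (hJ : ∀ p ∈ F, (J p).Nonempty) :
    ∃ S ⊆ F, ∃ E : ι → Set ℝ,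
      (∀ p ∈ S, MeasurableSet (E p) ∧ E p ⊆ I p ∧ volume (I p) ≤ 2 * volume (E p)) ∧
      (∀ p ∈ S, ∀ q ∈ S, p ≠ q → (J p ∩ J q).Nonempty → Disjoint (E p) (E q)) ∧
      ∀ p ∈ F, volume (I p) ≤ 2 * volume
        (I p ∩ ⋃ q ∈ S, ⋃ (_ : (J p ∩ J q).Nonempty ∧ len p ≤ len q), I q) := by
  induction F using Finset.induction_on_min_value len with
  | empty => exact ⟨∅, subset_rfl, fun _ => ∅, by simp, by simp, by simp⟩
  | insert p s hps hmin ih =>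
    obtain ⟨S, hSs, E, hE, hdisj, hcov⟩ := ih fun q hq => hJ q (Finset.mem_insert_of_mem hq)
    set B := ⋃ q ∈ S, ⋃ (_ : (J p ∩ J q).Nonempty ∧ len p ≤ len q), I q with hB
    have hBm : MeasurableSet B :=
      Finset.measurableSet_biUnion _ fun q _ => MeasurableSet.iUnion fun _ => hI q
    by_cases hp : volume (I p) ≤ 2 * volume (I p ∩ B)
    · refine ⟨S, hSs.trans (Finset.subset_insert _ _), E, hE, hdisj, fun q hq => ?_⟩
      rcases Finset.mem_insert.1 hq with rfl | hq
      · exact hp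
      · exact hcov q hq
    · have hpS : p ∉ S := fun h => hps (hSs h)
      have hne : ∀ q ∈ S, q ≠ p := fun q hq h => hpS (h ▸ hq)
      refine ⟨insert p S, Finset.insert_subset_insert _ hSs, Function.update E p (I p \ B),
        ?_, ?_, ?_⟩
      · intro q hq
        rcases Finset.mem_insert.1 hq with rfl | hq
        · simp only [Function.update_self]
          refine ⟨(hI _).diff hBm, Set.sdiff_subset, ?_⟩
          have h1 := measure_inter_add_sdiff (μ := volume) (I q) hBm
          push Not at hp
          by_contra! h2
          have h3 : 2 * volume (I q ∩ B) + 2 * volume (I q \ B) < volume (I q) + volume (I q) :=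
            ENNReal.add_lt_add hp h2
          rw [← mul_add, h1, two_mul] at h3
          exact lt_irrefl _ h3
        · rw [Function.update_of_ne (hne q hq)]
          exact hE q hq
      · have key : ∀ q ∈ S, (J p ∩ J q).Nonempty → Disjoint (I p \ B) (E q) := by
          intro q hq hpq
          refine Set.disjoint_left.2 fun x hx hxq => hx.2 ?_
          simp only [hB, Set.mem_iUnion]
          exact ⟨q, hq, ⟨hpq, hmin q (hSs hq)⟩, (hE q hq).2.1 hxq⟩
        intro q hq q' hq' hqq' hJJ
        rcases Finset.mem_insert.1 hq with rfl | hq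
        · rcases Finset.mem_insert.1 hq' with rfl | hq'
          · exact absurd rfl hqq'
          · rw [Function.update_self, Function.update_of_ne (hne q' hq')]
            exact key q' hq' hJJ
        · rcases Finset.mem_insert.1 hq' with hq'p | hq'
          · rw [hq'p] at hJJ ⊢
            rw [Function.update_self, Function.update_of_ne (hne q hq)]
            exact (key q hq (by rwa [Set.inter_comm])).symm
          · rw [Function.update_of_ne (hne q hq), Function.update_of_ne (hne q' hq')]
            exact hdisj q hq q' hq' hqq' hJJ
      · intro q hq
        rcases Finset.mem_insert.1 hq with rfl | hq
        · rw [Set.inter_eq_self_of_subset_left, two_mul]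
          · exact le_self_add
          · refine fun x hx => Set.mem_iUnion₂.2 ⟨q, Finset.mem_insert_self _ _, ?_⟩
            exact Set.mem_iUnion.2 ⟨⟨by simpa using hJ q (Finset.mem_insert_self _ _), le_rfl⟩, hx⟩
        · refine (hcov q hq).trans ?_
          exact mul_le_mul' le_rfl (measure_mono (Set.inter_subset_inter_right _
            (Set.biUnion_subset_biUnion_left (Finset.coe_subset.2 (Finset.subset_insert p S)))))

theorem mul_volume_biUnion_Icc_le {ι : Type*} (T : Finset ι) (a b : ι → ℝ)
    (ψ : ℝ → ℝ≥0∞) (σ : ℝ≥0∞)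
    (h : ∀ p ∈ T, σ * volume (Set.Icc (a p) (b p)) ≤ ∫⁻ x in Set.Icc (a p) (b p), ψ x) :
    σ * volume (⋃ p ∈ T, Set.Icc (a p) (b p)) ≤ 5 * ∫⁻ x, ψ x := by
  have hIcc : ∀ p, Set.Icc (a p) (b p) =
      Metric.closedBall ((a p + b p) / 2) ((b p - a p) / 2) := fun p => by
    rw [Real.Icc_eq_closedBall]
  obtain ⟨R, hR⟩ : ∃ R : ℝ, ∀ p ∈ (T : Set ι), (b p - a p) / 2 ≤ R := by
    obtain ⟨R, hR⟩ := (T.finite_toSet.image fun p => (b p - a p) / 2).bddAbove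
    exact ⟨R, fun p hp => hR ⟨p, hp, rfl⟩⟩
  obtain ⟨u, huT, hdis, hcov⟩ := Vitali.exists_disjoint_subfamily_covering_enlargement_closedBall
    (T : Set ι) (fun p => (a p + b p) / 2) (fun p => (b p - a p) / 2) R hR 5 (by norm_num)
  have hu : u.Finite := T.finite_toSet.subset huT
  lift u to Finset ι using hu
  have hvol : ∀ p ∈ u, volume (Metric.closedBall ((a p + b p) / 2) (5 * ((b p - a p) / 2))) =
      5 * volume (Set.Icc (a p) (b p)) := fun p _ => by
    rw [Real.volume_closedBall, Real.volume_Icc, ← ENNReal.ofReal_ofNat 5,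
      ← ENNReal.ofReal_mul (by norm_num)]
    congr 1; ring
  calc σ * volume (⋃ p ∈ T, Set.Icc (a p) (b p))
      ≤ σ * volume (⋃ p ∈ u, Metric.closedBall ((a p + b p) / 2) (5 * ((b p - a p) / 2))) := by
        refine mul_le_mul' le_rfl (measure_mono (Set.iUnion₂_subset fun p hp => ?_))
        obtain ⟨q, hq, hpq⟩ := hcov p hp
        rw [hIcc]
        exact hpq.trans (Set.subset_biUnion_of_mem (u := fun q =>
          Metric.closedBall ((a q + b q) / 2) (5 * ((b q - a q) / 2))) hq)
    _ ≤ σ * ∑ p ∈ u, 5 * volume (Set.Icc (a p) (b p)) := by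
        gcongr
        exact (measure_biUnion_finset_le _ _).trans (Finset.sum_le_sum fun p hp => (hvol p hp).le)
    _ = 5 * ∑ p ∈ u, σ * volume (Set.Icc (a p) (b p)) := by
        rw [Finset.mul_sum, Finset.mul_sum]
        exact Finset.sum_congr rfl fun p _ => by ring
    _ ≤ 5 * ∑ p ∈ u, ∫⁻ x in Set.Icc (a p) (b p), ψ x := by
        gcongr with p hp
        exact h p (huT hp)
    _ = 5 * ∫⁻ x in ⋃ p ∈ u, Set.Icc (a p) (b p), ψ x := by
        rw [lintegral_biUnion_finset _ fun p _ => measurableSet_Icc]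
        simpa only [hIcc] using hdis
    _ ≤ 5 * ∫⁻ x, ψ x := by gcongr; exact Measure.restrict_le_self

theorem setLIntegral_Ioi_half_inv_le (y : ℝ) :
    ∫⁻ s in Set.Ioi (1 / 2 : ℝ), (if s < 2 * y then ENNReal.ofReal s⁻¹ else 0) ≤
      ENNReal.ofReal (max 0 (Real.log (4 * y))) := by
  rcases le_or_gt (2 * y) (1 / 2) with hy | hy
  · rw [setLIntegral_congr_fun (g := fun _ => 0) measurableSet_Ioi]
    · simp
    · intro s hs
      have hs' : 1 / 2 < s := hs
      simp only [ite_eq_right_iff]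
      intro h
      linarith
  · have h1 : ∀ s ∈ Set.Ioc (1 / 2 : ℝ) (2 * y), 0 ≤ s⁻¹ := fun s hs =>
      inv_nonneg.2 (by linarith [hs.1])
    calc ∫⁻ s in Set.Ioi (1 / 2 : ℝ), (if s < 2 * y then ENNReal.ofReal s⁻¹ else 0)
        ≤ ∫⁻ s in Set.Ioi (1 / 2 : ℝ),
            (Set.Ioc (1 / 2 : ℝ) (2 * y)).indicator (fun s => ENNReal.ofReal s⁻¹) s := by
          refine setLIntegral_mono' measurableSet_Ioi fun s hs => ?_
          split_ifs with h
          · rw [Set.indicator_of_mem (show s ∈ Set.Ioc (1 / 2 : ℝ) (2 * y) from ⟨hs, h.le⟩)]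
          · exact zero_le
      _ ≤ ∫⁻ s in Set.Ioc (1 / 2 : ℝ) (2 * y), ENNReal.ofReal s⁻¹ := by
          rw [← lintegral_indicator measurableSet_Ioc]
          exact setLIntegral_le_lintegral _ _
      _ = ENNReal.ofReal (∫ s in (1 / 2 : ℝ)..(2 * y), s⁻¹) := by
          rw [intervalIntegral.integral_of_le hy.le, ofReal_integral_eq_lintegral_ofReal]
          · have := intervalIntegral.intervalIntegrable_inv (μ := volume) (a := 1 / 2) (b := 2 * y)
              (f := fun s : ℝ => s) (fun x hx => ?_) continuousOn_id
            · exact (intervalIntegrable_iff_integrableOn_Ioc_of_le hy.le).1 this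
            · rw [Set.uIcc_of_le hy.le] at hx
              have := hx.1
              intro h0
              linarith
          · exact (ae_restrict_iff' measurableSet_Ioc).2 (ae_of_all _ h1)
      _ ≤ ENNReal.ofReal (max 0 (Real.log (4 * y))) := by
          rw [integral_inv_of_pos (by norm_num) (by linarith)]
          refine ENNReal.ofReal_le_ofReal (le_max_of_le_right (le_of_eq ?_))
          congr 1; ring

theorem le_half_mul_add_setLIntegral (K V : ℝ≥0∞) (hV0 : V ≠ 0) (hV : V ≠ ∞) :
    K ≤ 2⁻¹ * V +
      ∫⁻ s in Set.Ioi (1 / 2 : ℝ), (if ENNReal.ofReal s * V < K then V else 0) := by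
  refine ENNReal.le_of_forall_nnreal_lt fun r hr => ?_
  lift V to NNReal using hV
  have hV0' : (0 : ℝ) < V := NNReal.coe_pos.2 (pos_iff_ne_zero.2 (by exact_mod_cast hV0))
  calc (r : ℝ≥0∞) ≤ 2⁻¹ * V + V * volume (Set.Ioc (1 / 2 : ℝ) (r / V)) := by
        rw [Real.volume_Ioc, ← ENNReal.ofReal_coe_nnreal (p := V), ← ENNReal.ofReal_mul hV0'.le,
          ← ENNReal.ofReal_coe_nnreal (p := r), ← ENNReal.ofReal_ofNat 2,
          ← ENNReal.ofReal_inv_of_pos (by norm_num), ← ENNReal.ofReal_mul (by norm_num)]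
        refine le_trans (ENNReal.ofReal_le_ofReal (le_of_eq ?_)) ENNReal.ofReal_add_le
        field_simp
        ring
    _ = 2⁻¹ * V + ∫⁻ s in Set.Ioi (1 / 2 : ℝ),
          (Set.Ioc (1 / 2 : ℝ) (r / V)).indicator (fun _ => (V : ℝ≥0∞)) s := by
        rw [lintegral_indicator measurableSet_Ioc, setLIntegral_const,
          Measure.restrict_apply measurableSet_Ioc,
          Set.inter_eq_self_of_subset_left (fun s hs => hs.1)]
    _ ≤ _ := by
        gcongr with s
        by_cases hs : s ∈ Set.Ioc (1 / 2 : ℝ) (r / V)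
        · rw [Set.indicator_of_mem hs, if_pos]
          refine lt_of_le_of_lt ?_ hr
          rw [← ENNReal.ofReal_coe_nnreal (p := V), ← ENNReal.ofReal_mul' hV0'.le,
            ← ENNReal.ofReal_coe_nnreal (p := r)]
          exact ENNReal.ofReal_le_ofReal ((le_div_iff₀ hV0').1 hs.2)
        · rw [Set.indicator_of_notMem hs]
          exact zero_le

/-- The one-dimensional `L log L` estimate for sparse families of intervals. -/
theorem sum_setLIntegral_Icc_le {ι : Type*} (T : Finset ι) (a b : ι → ℝ)
    (hab : ∀ p ∈ T, a p < b p) (E : ι → Set ℝ)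
    (hE : ∀ p ∈ T, MeasurableSet (E p) ∧ E p ⊆ Set.Icc (a p) (b p) ∧
      volume (Set.Icc (a p) (b p)) ≤ 2 * volume (E p))
    (hd : (T : Set ι).PairwiseDisjoint E) (φ : ℝ → ℝ) (hφ : Measurable φ) (hφ0 : ∀ x, 0 ≤ φ x) :
    ∑ p ∈ T, ∫⁻ x in Set.Icc (a p) (b p), ENNReal.ofReal (φ x) ≤
      2⁻¹ * ∑ p ∈ T, volume (Set.Icc (a p) (b p)) +
        20 * ∫⁻ x, ENNReal.ofReal (φ x * max 0 (Real.log (4 * φ x))) := by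
  set V : ι → ℝ≥0∞ := fun p => volume (Set.Icc (a p) (b p)) with hVdef
  set K : ι → ℝ≥0∞ := fun p => ∫⁻ x in Set.Icc (a p) (b p), ENNReal.ofReal (φ x) with hKdef
  have hVfin : ∀ p, V p ≠ ∞ := fun p => by simp [hVdef]
  have hV0 : ∀ p ∈ T, V p ≠ 0 := fun p hp => by simp [hVdef, hab p hp]
  have hlevel : ∀ s ∈ Set.Ioi (1 / 2 : ℝ),
      ∑ p ∈ T, (if ENNReal.ofReal s * V p < K p then V p else 0) ≤
        ∫⁻ x, 20 * ENNReal.ofReal (φ x) * (if s < 2 * φ x then ENNReal.ofReal s⁻¹ else 0) := by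
    intro s hs
    have hs0 : (0 : ℝ) < s := lt_trans (by norm_num) hs
    classical
    set T' := T.filter fun p => ENNReal.ofReal s * V p < K p with hT'
    have hT'T : ∀ p ∈ T', p ∈ T := fun p hp => (Finset.mem_filter.1 hp).1
    set ψ : ℝ → ℝ≥0∞ := fun x => ENNReal.ofReal (φ x) * (if s < 2 * φ x then 1 else 0) with hψ
    have h1 : ∀ p ∈ T', ENNReal.ofReal (s / 2) * V p ≤ ∫⁻ x in Set.Icc (a p) (b p), ψ x := by
      intro p hp
      have h2 : ENNReal.ofReal s * V p ≤
          ENNReal.ofReal (s / 2) * V p + ∫⁻ x in Set.Icc (a p) (b p), ψ x := by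
        refine (Finset.mem_filter.1 hp).2.le.trans ?_
        rw [hKdef, hVdef]
        simp only
        rw [← setLIntegral_const, ← lintegral_add_left measurable_const]
        refine lintegral_mono fun x => ?_
        simp only [hψ]
        split_ifs with h
        · rw [mul_one]; exact le_add_self
        · rw [mul_zero, add_zero]
          exact ENNReal.ofReal_le_ofReal (by linarith)
      have h3 : ENNReal.ofReal s = ENNReal.ofReal (s / 2) + ENNReal.ofReal (s / 2) := by
        rw [← ENNReal.ofReal_add (by positivity) (by positivity)]; congr 1; ring
      rw [h3, add_mul] at h2
      exact (ENNReal.add_le_add_iff_left (ENNReal.mul_ne_top ENNReal.ofReal_ne_top (hVfin p))).1 h2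
    have h4 := mul_volume_biUnion_Icc_le T' a b ψ _ h1
    calc ∑ p ∈ T, (if ENNReal.ofReal s * V p < K p then V p else 0)
        = ∑ p ∈ T', V p := by rw [hT', Finset.sum_filter]
      _ ≤ ∑ p ∈ T', 2 * volume (E p) := Finset.sum_le_sum fun p hp => (hE p (hT'T p hp)).2.2
      _ = 2 * volume (⋃ p ∈ T', E p) := by
          rw [← Finset.mul_sum, measure_biUnion_finset (hd.subset fun p hp => hT'T p hp)
            fun p hp => (hE p (hT'T p hp)).1]
      _ ≤ 2 * volume (⋃ p ∈ T', Set.Icc (a p) (b p)) :=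
          mul_le_mul' le_rfl (measure_mono
            (Set.iUnion₂_mono fun p hp => (hE p (hT'T p hp)).2.1))
      _ = 4 * ENNReal.ofReal s⁻¹ *
            (ENNReal.ofReal (s / 2) * volume (⋃ p ∈ T', Set.Icc (a p) (b p))) := by
          rw [← mul_assoc, ← ENNReal.ofReal_ofNat 4, ← ENNReal.ofReal_ofNat 2,
            ← ENNReal.ofReal_mul (by norm_num), ← ENNReal.ofReal_mul (by positivity)]
          congr 2
          field_simp; norm_num
      _ ≤ 4 * ENNReal.ofReal s⁻¹ * (5 * ∫⁻ x, ψ x) := by gcongr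
      _ = 20 * ENNReal.ofReal s⁻¹ * ∫⁻ x, ψ x := by ring
      _ = _ := by
          rw [← lintegral_const_mul' _ _ (by finiteness)]
          refine lintegral_congr fun x => ?_
          simp only [hψ]
          split_ifs
          · ring
          · simp
  calc ∑ p ∈ T, K p
      ≤ ∑ p ∈ T, (2⁻¹ * V p +
          ∫⁻ s in Set.Ioi (1 / 2 : ℝ), (if ENNReal.ofReal s * V p < K p then V p else 0)) :=
        Finset.sum_le_sum fun p hp => le_half_mul_add_setLIntegral _ _ (hV0 p hp) (hVfin p)
    _ = 2⁻¹ * ∑ p ∈ T, V p + ∫⁻ s in Set.Ioi (1 / 2 : ℝ),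
          ∑ p ∈ T, (if ENNReal.ofReal s * V p < K p then V p else 0) := by
        rw [Finset.sum_add_distrib, Finset.mul_sum, lintegral_finsetSum]
        exact fun p _ => Measurable.ite (measurableSet_lt (by fun_prop) measurable_const)
          measurable_const measurable_const
    _ ≤ 2⁻¹ * ∑ p ∈ T, V p + ∫⁻ s in Set.Ioi (1 / 2 : ℝ), ∫⁻ x,
          20 * ENNReal.ofReal (φ x) * (if s < 2 * φ x then ENNReal.ofReal s⁻¹ else 0) := by
        gcongr 2⁻¹ * _ + ?_
        exact setLIntegral_mono' measurableSet_Ioi hlevel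
    _ = 2⁻¹ * ∑ p ∈ T, V p + ∫⁻ x, ∫⁻ s in Set.Ioi (1 / 2 : ℝ),
          20 * ENNReal.ofReal (φ x) * (if s < 2 * φ x then ENNReal.ofReal s⁻¹ else 0) := by
        rw [lintegral_lintegral_swap]
        refine Measurable.aemeasurable (Measurable.mul (by fun_prop) (Measurable.ite
          (measurableSet_lt (by fun_prop) (by fun_prop)) (by fun_prop) measurable_const))
    _ ≤ 2⁻¹ * ∑ p ∈ T, V p +
          ∫⁻ x, 20 * ENNReal.ofReal (φ x * max 0 (Real.log (4 * φ x))) := by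
        gcongr with x
        rw [lintegral_const_mul' _ _ (by finiteness), ENNReal.ofReal_mul (hφ0 x), ← mul_assoc]
        gcongr
        exact setLIntegral_Ioi_half_inv_le (φ x)
    _ = _ := by rw [lintegral_const_mul' _ _ (by finiteness)]

theorem mul_max_log_four_mul_le (y : ℝ) (hy : 0 ≤ y) :
    y * max 0 (Real.log (4 * y)) ≤ 2 * (y * (1 + max 0 (Real.log y))) := by
  rcases hy.eq_or_lt with rfl | hy
  · simp
  have h4 : Real.log 4 ≤ 2 := by
    have h : Real.log 4 = 2 * Real.log 2 := by
      rw [← Real.log_rpow two_pos]; norm_num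
    linarith [Real.log_two_lt_d9]
  have : max 0 (Real.log (4 * y)) ≤ 2 * (1 + max 0 (Real.log y)) := by
    rw [Real.log_mul (by norm_num) hy.ne']
    have h0 := le_max_left 0 (Real.log y)
    have h1 := le_max_right 0 (Real.log y)
    exact max_le (by linarith) (by linarith)
  nlinarith

/-- The `L log L` bound for the total area of a family of plane rectangles with sparse slices. -/
theorem sum_volume_prod_le {ι : Type*} (T : Finset ι) (a b : ι → ℝ)
    (hab : ∀ p ∈ T, a p < b p) (J : ι → Set ℝ) (hJm : ∀ p, MeasurableSet (J p))
    (hJ : ∀ p, volume (J p) ≠ ∞) (E : ι → Set ℝ)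
    (hE : ∀ p ∈ T, MeasurableSet (E p) ∧ E p ⊆ Set.Icc (a p) (b p) ∧
      volume (Set.Icc (a p) (b p)) ≤ 2 * volume (E p))
    (hd : ∀ p ∈ T, ∀ q ∈ T, p ≠ q → (J p ∩ J q).Nonempty → Disjoint (E p) (E q))
    (g : ℝ × ℝ → ℝ) (hg : Measurable g) (hg0 : ∀ z, 0 ≤ g z)
    (h : ∀ p ∈ T, volume (Set.Icc (a p) (b p) ×ˢ J p) ≤
      ∫⁻ z in Set.Icc (a p) (b p) ×ˢ J p, ENNReal.ofReal (g z)) :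
    ∑ p ∈ T, volume (Set.Icc (a p) (b p) ×ˢ J p) ≤
      80 * ∫⁻ z, ENNReal.ofReal (g z * (1 + max 0 (Real.log (g z)))) := by
  classical
  set A := ∑ p ∈ T, volume (Set.Icc (a p) (b p) ×ˢ J p) with hA
  have hAvol : ∀ p, volume (Set.Icc (a p) (b p) ×ˢ J p) =
      volume (Set.Icc (a p) (b p)) * volume (J p) := fun p => Measure.prod_prod _ _
  have hAfin : A ≠ ∞ := by
    refine ENNReal.sum_ne_top.2 fun p _ => ?_
    rw [hAvol]
    exact ENNReal.mul_ne_top (by simp) (hJ p)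
  have hslice : ∀ y : ℝ,
      ∑ p ∈ T, (J p).indicator
        (fun y => ∫⁻ x in Set.Icc (a p) (b p), ENNReal.ofReal (g (x, y))) y ≤
      2⁻¹ * ∑ p ∈ T, (J p).indicator (fun _ => volume (Set.Icc (a p) (b p))) y +
        20 * ∫⁻ x, ENNReal.ofReal (g (x, y) * max 0 (Real.log (4 * g (x, y)))) := by
    intro y
    simp only [Set.indicator_apply]
    rw [← Finset.sum_filter, ← Finset.sum_filter]
    have hT : ∀ p ∈ T.filter fun p => y ∈ J p, p ∈ T := fun p hp => (Finset.mem_filter.1 hp).1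
    refine sum_setLIntegral_Icc_le _ a b (fun p hp => hab p (hT p hp)) E
      (fun p hp => hE p (hT p hp)) (fun p hp q hq hpq => ?_) (fun x => g (x, y))
      (hg.comp measurable_prodMk_right) (fun x => hg0 _)
    exact hd p (hT p hp) q (hT q hq) hpq
      ⟨y, (Finset.mem_filter.1 hp).2, (Finset.mem_filter.1 hq).2⟩
  have hmeas : Measurable fun z : ℝ × ℝ =>
      ENNReal.ofReal (g z * max 0 (Real.log (4 * g z))) := by fun_prop
  have hmain : A ≤ 2⁻¹ * A +
      20 * ∫⁻ z, ENNReal.ofReal (g z * max 0 (Real.log (4 * g z))) := by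
    calc A ≤ ∑ p ∈ T, ∫⁻ z in Set.Icc (a p) (b p) ×ˢ J p, ENNReal.ofReal (g z) :=
          Finset.sum_le_sum h
      _ = ∑ p ∈ T, ∫⁻ y, (J p).indicator
            (fun y => ∫⁻ x in Set.Icc (a p) (b p), ENNReal.ofReal (g (x, y))) y := by
          refine Finset.sum_congr rfl fun p _ => ?_
          rw [lintegral_indicator (hJm p), Measure.volume_eq_prod, ← Measure.prod_restrict,
            lintegral_prod_symm _ (by fun_prop)]
      _ = ∫⁻ y, ∑ p ∈ T, (J p).indicator
            (fun y => ∫⁻ x in Set.Icc (a p) (b p), ENNReal.ofReal (g (x, y))) y := by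
          rw [lintegral_finsetSum]
          exact fun p _ => (Measurable.lintegral_prod_left'
            (f := fun z : ℝ × ℝ => ENNReal.ofReal (g z)) (by fun_prop)).indicator (hJm p)
      _ ≤ ∫⁻ y, (2⁻¹ * ∑ p ∈ T, (J p).indicator (fun _ => volume (Set.Icc (a p) (b p))) y +
            20 * ∫⁻ x, ENNReal.ofReal (g (x, y) * max 0 (Real.log (4 * g (x, y))))) :=
          lintegral_mono hslice
      _ = 2⁻¹ * A + 20 * ∫⁻ z, ENNReal.ofReal (g z * max 0 (Real.log (4 * g z))) := by
          rw [lintegral_add_left, lintegral_const_mul' _ _ (by finiteness),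
            lintegral_const_mul' _ _ (by finiteness), lintegral_finsetSum,
            Measure.volume_eq_prod, lintegral_prod_symm _ hmeas.aemeasurable]
          · congr 2
            refine Finset.sum_congr rfl fun p _ => ?_
            rw [lintegral_indicator_const (hJm p), hAvol]
          · exact fun p _ => measurable_const.indicator (hJm p)
          · exact Measurable.const_mul (Finset.measurable_fun_sum _ fun p _ =>
              measurable_const.indicator (hJm p)) _
  set X := ∫⁻ z, ENNReal.ofReal (g z * (1 + max 0 (Real.log (g z)))) with hX
  have hXle : ∫⁻ z, ENNReal.ofReal (g z * max 0 (Real.log (4 * g z))) ≤ 2 * X := by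
    rw [hX, ← lintegral_const_mul' _ _ (by finiteness)]
    refine lintegral_mono fun z => ?_
    rw [← ENNReal.ofReal_ofNat 2, ← ENNReal.ofReal_mul (by norm_num)]
    exact ENNReal.ofReal_le_ofReal (mul_max_log_four_mul_le _ (hg0 z))
  have hhalf : 2⁻¹ * A + 2⁻¹ * A = A := by rw [← add_mul, ENNReal.inv_two_add_inv_two, one_mul]
  have h1 : 2⁻¹ * A ≤ 40 * X := by
    have h2 : 2⁻¹ * A + 2⁻¹ * A ≤ 2⁻¹ * A + 40 * X := by
      rw [hhalf]
      refine hmain.trans ?_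
      gcongr 2⁻¹ * A + ?_
      calc _ ≤ 20 * (2 * X) := by gcongr
        _ = 40 * X := by ring
    exact (ENNReal.add_le_add_iff_left (ENNReal.mul_ne_top (by simp) hAfin)).1 h2
  calc A = 2⁻¹ * A + 2⁻¹ * A := hhalf.symm
    _ ≤ 40 * X + 40 * X := add_le_add h1 h1
    _ = 80 * X := by ring

theorem sum_volume_prod_le_setLIntegral {ι : Type*} (T : Finset ι) (a b : ι → ℝ)
    (hab : ∀ p ∈ T, a p < b p) (J : ι → Set ℝ) (hJm : ∀ p, MeasurableSet (J p))
    (hJ : ∀ p, volume (J p) ≠ ∞) (E : ι → Set ℝ)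
    (hE : ∀ p ∈ T, MeasurableSet (E p) ∧ E p ⊆ Set.Icc (a p) (b p) ∧
      volume (Set.Icc (a p) (b p)) ≤ 2 * volume (E p))
    (hd : ∀ p ∈ T, ∀ q ∈ T, p ≠ q → (J p ∩ J q).Nonempty → Disjoint (E p) (E q))
    (g : ℝ × ℝ → ℝ) (hg : Measurable g) (hg0 : ∀ z, 0 ≤ g z)
    (h : ∀ p ∈ T, volume (Set.Icc (a p) (b p) ×ˢ J p) ≤
      ∫⁻ z in Set.Icc (a p) (b p) ×ˢ J p, ENNReal.ofReal (g z)) :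
    ∑ p ∈ T, volume (Set.Icc (a p) (b p) ×ˢ J p) ≤
      80 * ∫⁻ z in ⋃ p ∈ T, Set.Icc (a p) (b p) ×ˢ J p,
        ENNReal.ofReal (g z * (1 + max 0 (Real.log (g z)))) := by
  set U := ⋃ p ∈ T, Set.Icc (a p) (b p) ×ˢ J p with hU
  have hR : ∀ p, MeasurableSet (Set.Icc (a p) (b p) ×ˢ J p) := fun p =>
    measurableSet_Icc.prod (hJm p)
  have hUm : MeasurableSet U := Finset.measurableSet_biUnion _ fun p _ => hR p
  refine (sum_volume_prod_le T a b hab J hJm hJ E hE hd (U.indicator g) (hg.indicator hUm)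
    (fun z => Set.indicator_nonneg (fun z _ => hg0 z) z) fun p hp => ?_).trans (le_of_eq ?_)
  · refine (h p hp).trans (le_of_eq (setLIntegral_congr_fun (hR p) fun z hz => ?_))
    have hzU : z ∈ U := Set.mem_biUnion (t := fun p => Set.Icc (a p) (b p) ×ˢ J p) hp hz
    simp only [Set.indicator_of_mem hzU]
  · rw [← lintegral_indicator hUm]
    congr 1
    refine lintegral_congr fun z => ?_
    by_cases hz : z ∈ U <;> simp [hz]

theorem eq_setLIntegral_Ioi_ite (c : ℝ≥0∞) :
    c = ∫⁻ s in Set.Ioi (0 : ℝ), (if ENNReal.ofReal s < c then 1 else 0) := by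
  have h : (fun s : ℝ => if ENNReal.ofReal s < c then (1 : ℝ≥0∞) else 0) =
      {s : ℝ | ENNReal.ofReal s < c}.indicator 1 := by
    ext s
    simp [Set.indicator_apply]
  rw [h, lintegral_indicator_one (measurableSet_lt (by fun_prop) measurable_const),
    Measure.restrict_apply (measurableSet_lt (by fun_prop) measurable_const)]
  induction c with
  | top => simp
  | coe r =>
    have : {s : ℝ | ENNReal.ofReal s < r} ∩ Set.Ioi 0 = Set.Ioo 0 (r : ℝ) := by
      ext s
      simp only [Set.mem_inter_iff, Set.mem_ofPred_eq, Set.mem_Ioi, Set.mem_Ioo]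
      refine ⟨fun hs => ⟨hs.2, ?_⟩, fun hs => ⟨?_, hs.1⟩⟩
      · have := hs.1
        rwa [← ENNReal.ofReal_coe_nnreal, ENNReal.ofReal_lt_ofReal_iff_of_nonneg hs.2.le] at this
      · rw [← ENNReal.ofReal_coe_nnreal, ENNReal.ofReal_lt_ofReal_iff_of_nonneg hs.1.le]
        exact hs.2
    rw [this, Real.volume_Ioo, sub_zero, ENNReal.ofReal_coe_nnreal]

/-- A Carleson-type packing condition for all subfamilies yields the weighted packing bound. -/
theorem sum_mul_le_lintegral_iSup_indicator {ι α : Type*} [MeasurableSpace α] (μ : Measure α)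
    [SFinite μ] (S : Finset ι) (R : ι → Set α) (hR : ∀ p, MeasurableSet (R p)) (m c : ι → ℝ≥0∞)
    (h : ∀ T ⊆ S, ∑ p ∈ T, m p ≤ μ (⋃ p ∈ T, R p)) :
    ∑ p ∈ S, c p * m p ≤ ∫⁻ x, ⨆ p ∈ S, (R p).indicator (fun _ => c p) x ∂μ := by
  classical
  set W : α → ℝ≥0∞ := fun x => ⨆ p ∈ S, (R p).indicator (fun _ => c p) x with hW
  have hWm : Measurable W := Measurable.biSup _ S.countable_toSet fun p _ =>
    measurable_const.indicator (hR p)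
  have hset : ∀ s : ℝ, {x | ENNReal.ofReal s < W x} =
      ⋃ p ∈ S.filter fun p => ENNReal.ofReal s < c p, R p := by
    intro s
    ext x
    simp only [hW, Set.mem_ofPred_eq, lt_iSup_iff, Set.mem_iUnion, Finset.mem_filter, exists_prop]
    refine exists_congr fun p => ?_
    by_cases hx : x ∈ R p <;> simp [hx]
  calc ∑ p ∈ S, c p * m p
      = ∑ p ∈ S, ∫⁻ s in Set.Ioi (0 : ℝ), (if ENNReal.ofReal s < c p then 1 else 0) * m p := by
        refine Finset.sum_congr rfl fun p _ => ?_
        rw [lintegral_mul_const, ← eq_setLIntegral_Ioi_ite]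
        exact Measurable.ite (measurableSet_lt (by fun_prop) measurable_const)
          measurable_const measurable_const
    _ = ∫⁻ s in Set.Ioi (0 : ℝ), ∑ p ∈ S, (if ENNReal.ofReal s < c p then 1 else 0) * m p := by
        rw [lintegral_finsetSum]
        exact fun p _ => (Measurable.ite (measurableSet_lt (by fun_prop) measurable_const)
          measurable_const measurable_const).mul_const _
    _ ≤ ∫⁻ s in Set.Ioi (0 : ℝ), ∫⁻ x, (if ENNReal.ofReal s < W x then 1 else 0) ∂μ := by
        refine lintegral_mono fun s => ?_
        have h1 : (fun x => if ENNReal.ofReal s < W x then (1 : ℝ≥0∞) else 0) =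
            {x | ENNReal.ofReal s < W x}.indicator 1 := by
          ext x
          simp [Set.indicator_apply]
        rw [h1, lintegral_indicator_one (measurableSet_lt measurable_const hWm), hset]
        refine le_trans (le_of_eq ?_) (h _ (Finset.filter_subset _ _))
        rw [Finset.sum_filter]
        simp only [ite_mul, one_mul, zero_mul]
    _ = ∫⁻ x, (∫⁻ s in Set.Ioi (0 : ℝ), (if ENNReal.ofReal s < W x then 1 else 0)) ∂μ := by
        rw [lintegral_lintegral_swap]
        exact (Measurable.ite (measurableSet_lt (by fun_prop) (by fun_prop))
          measurable_const measurable_const).aemeasurable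
    _ = ∫⁻ x, W x ∂μ := lintegral_congr fun x => (eq_setLIntegral_Ioi_ite (W x)).symm

theorem average_le_strongMaximal {d c : ℕ} (f : (Fin d → ℝ) → ℝ≥0∞) {a b x : Fin d → ℝ}
    (hab : ∀ i, a i < b i)
    (hc : (Finset.image (fun i => b i - a i) Finset.univ).card ≤ c) (hx : x ∈ Set.Icc a b) :
    (∫⁻ y in Set.Icc a b, f y) / volume (Set.Icc a b) ≤ strongMaximal d c f x := by
  unfold strongMaximal
  exact le_iSup₂_of_le a b (le_iSup₂_of_le hab hc (le_iSup_of_le hx le_rfl))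

theorem volume_Icc_ne_zero {d : ℕ} {a b : Fin d → ℝ} (hab : ∀ i, a i < b i) :
    volume (Set.Icc a b) ≠ 0 := by
  rw [Real.volume_Icc_pi]
  exact Finset.prod_ne_zero_iff.2 fun i _ => by simp [hab i]

theorem volume_Icc_ne_top {d : ℕ} (a b : Fin d → ℝ) : volume (Set.Icc a b) ≠ ∞ :=
  isCompact_Icc.measure_lt_top.ne

theorem closedBall_eq_Icc_pi {d : ℕ} (z : Fin d → ℝ) {r : ℝ} (hr : 0 ≤ r) :
    Metric.closedBall z r = Set.Icc (fun i => z i - r) (fun i => z i + r) := by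
  rw [closedBall_pi z hr, ← Set.pi_univ_Icc]
  simp only [Real.closedBall_eq_Icc]

/-- The Fefferman–Stein weak type inequality for a family of squares each of which is half
covered by `U`. -/
theorem setLIntegral_biUnion_closedBall_le (w : (Fin 2 → ℝ) → ℝ≥0∞)
    (G : Set ((Fin 2 → ℝ) × ℝ)) (R : ℝ) (hpos : ∀ q ∈ G, 0 < q.2) (hR : ∀ q ∈ G, q.2 ≤ R)
    (U : Set (Fin 2 → ℝ)) (hU : MeasurableSet U)
    (h : ∀ q ∈ G, volume (Metric.closedBall q.1 q.2) ≤
      2 * volume (Metric.closedBall q.1 q.2 ∩ U)) :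
    ∫⁻ x in ⋃ q ∈ G, Metric.closedBall q.1 q.2, w x ≤
      50 * ∫⁻ x in U, strongMaximal 2 1 w x := by
  obtain ⟨u, huG, hdis, hcov⟩ := Vitali.exists_disjoint_subfamily_covering_enlargement_closedBall
    G Prod.fst Prod.snd R hR 5 (by norm_num)
  have hu : u.Countable := hdis.countable_of_nonempty_interior fun q hq =>
    ⟨q.1, Metric.ball_subset_interior_closedBall (Metric.mem_ball_self (hpos q (huG hq)))⟩
  have hball : ∀ q ∈ u, ∫⁻ x in Metric.closedBall q.1 (5 * q.2), w x ≤
      50 * ∫⁻ x in Metric.closedBall q.1 q.2 ∩ U, strongMaximal 2 1 w x := by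
    intro q hq
    have hq0 := hpos q (huG hq)
    have hab : ∀ i, q.1 i - 5 * q.2 < q.1 i + 5 * q.2 := fun i => by linarith
    have hball5 := closedBall_eq_Icc_pi q.1 (r := 5 * q.2) (by positivity)
    set Q := Metric.closedBall q.1 q.2
    set Q5 := Metric.closedBall q.1 (5 * q.2) with hQ5
    set m := (∫⁻ y in Q5, w y) / volume Q5
    have hvol0 : volume Q5 ≠ 0 := by rw [hball5]; exact volume_Icc_ne_zero hab
    have hvolt : volume Q5 ≠ ∞ := by rw [hball5]; exact volume_Icc_ne_top _ _
    have hm : ∀ x ∈ Q, m ≤ strongMaximal 2 1 w x := by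
      intro x hx
      have hx5 : x ∈ Q5 := Metric.closedBall_subset_closedBall (by linarith) hx
      rw [hball5] at hx5
      have := average_le_strongMaximal (c := 1) w hab (by
        rw [show (fun i : Fin 2 => q.1 i + 5 * q.2 - (q.1 i - 5 * q.2)) = fun _ => 10 * q.2 by
          ext i; ring, Finset.image_const Finset.univ_nonempty, Finset.card_singleton]) hx5
      rwa [← hball5] at this
    calc ∫⁻ x in Q5, w x = m * volume Q5 := (ENNReal.div_mul_cancel hvol0 hvolt).symm
      _ = m * (25 * volume Q) := by
          rw [Real.volume_pi_closedBall _ (by positivity), Real.volume_pi_closedBall _ hq0.le,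
            ← ENNReal.ofReal_ofNat 25, ← ENNReal.ofReal_mul (by norm_num)]
          congr 2
          simp only [Fintype.card_fin]
          ring
      _ ≤ m * (25 * (2 * volume (Q ∩ U))) := by gcongr; exact h q (huG hq)
      _ = 50 * ∫⁻ _ in Q ∩ U, m := by rw [setLIntegral_const]; ring
      _ ≤ 50 * ∫⁻ x in Q ∩ U, strongMaximal 2 1 w x := by
          gcongr 50 * ?_
          exact setLIntegral_mono' (Metric.isClosed_closedBall.measurableSet.inter hU)
            fun x hx => hm x hx.1
  have := hu.to_subtype
  calc ∫⁻ x in ⋃ q ∈ G, Metric.closedBall q.1 q.2, w x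
      ≤ ∫⁻ x in ⋃ q : u, Metric.closedBall q.1.1 (5 * q.1.2), w x := by
        refine lintegral_mono_set (Set.iUnion₂_subset fun q hq => ?_)
        obtain ⟨b, hb, hqb⟩ := hcov q hq
        exact hqb.trans (Set.subset_iUnion (fun q : u => Metric.closedBall q.1.1 (5 * q.1.2))
          ⟨b, hb⟩)
    _ ≤ ∑' q : u, ∫⁻ x in Metric.closedBall q.1.1 (5 * q.1.2), w x := lintegral_iUnion_le _ _
    _ ≤ ∑' q : u, 50 * ∫⁻ x in Metric.closedBall q.1.1 q.1.2 ∩ U, strongMaximal 2 1 w x :=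
        ENNReal.tsum_le_tsum fun q => hball q.1 q.2
    _ = 50 * ∫⁻ x in ⋃ q : u, Metric.closedBall q.1.1 q.1.2 ∩ U, strongMaximal 2 1 w x := by
        rw [ENNReal.tsum_mul_left, lintegral_iUnion
          fun q => Metric.isClosed_closedBall.measurableSet.inter hU]
        exact fun i j hij => (hdis i.2 j.2 (Subtype.coe_injective.ne hij)).mono
          Set.inter_subset_left Set.inter_subset_left
    _ ≤ 50 * ∫⁻ x in U, strongMaximal 2 1 w x := by
        gcongr 50 * ?_
        exact lintegral_mono_set (Set.iUnion_subset fun q => Set.inter_subset_right)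

theorem exists_measurableEquiv_coords {k l : Fin 2} (hkl : k ≠ l) :
    ∃ e : (Fin 2 → ℝ) ≃ᵐ ℝ × ℝ, MeasurePreserving e ∧ ∀ x, e x = (x k, x l) := by
  have h := volume_preserving_finTwoArrow ℝ
  rcases (by omega : (k = 0 ∧ l = 1) ∨ (k = 1 ∧ l = 0)) with ⟨rfl, rfl⟩ | ⟨rfl, rfl⟩
  · exact ⟨MeasurableEquiv.finTwoArrow, h, fun x => rfl⟩
  · exact ⟨MeasurableEquiv.finTwoArrow.trans MeasurableEquiv.prodComm,
      Measure.measurePreserving_swap.comp h, fun x => rfl⟩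

theorem Icc_eq_coords {k l : Fin 2} (hkl : k ≠ l) (a b : Fin 2 → ℝ) :
    Set.Icc a b = {x | x k ∈ Set.Icc (a k) (b k) ∧ x l ∈ Set.Icc (a l) (b l)} := by
  ext x
  have : ∀ P : Fin 2 → Prop, (∀ i, P i) ↔ P k ∧ P l := by
    intro P
    rw [Fin.forall_fin_two]
    rcases (by omega : (k = 0 ∧ l = 1) ∨ (k = 1 ∧ l = 0)) with ⟨rfl, rfl⟩ | ⟨rfl, rfl⟩
    · rfl
    · exact and_comm
  simp only [Set.mem_Icc, Pi.le_def, this, Set.mem_ofPred_eq]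
  tauto

theorem volume_coords {k l : Fin 2} (hkl : k ≠ l) {A B : Set ℝ} (hA : MeasurableSet A)
    (hB : MeasurableSet B) :
    volume {x : Fin 2 → ℝ | x k ∈ A ∧ x l ∈ B} = volume A * volume B := by
  obtain ⟨e, he, hex⟩ := exists_measurableEquiv_coords hkl
  have : {x : Fin 2 → ℝ | x k ∈ A ∧ x l ∈ B} = e ⁻¹' (A ×ˢ B) := by
    ext x
    simp [hex]
  rw [this, he.measure_preimage (hA.prod hB).nullMeasurableSet]
  exact Measure.prod_prod _ _

theorem sum_volume_Icc_le {k l : Fin 2} (hkl : k ≠ l)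
    (T : Finset ((Fin 2 → ℝ) × (Fin 2 → ℝ))) (hT : ∀ p ∈ T, ∀ i, p.1 i < p.2 i)
    (E : (Fin 2 → ℝ) × (Fin 2 → ℝ) → Set ℝ)
    (hE : ∀ p ∈ T, MeasurableSet (E p) ∧ E p ⊆ Set.Icc (p.1 k) (p.2 k) ∧
      volume (Set.Icc (p.1 k) (p.2 k)) ≤ 2 * volume (E p))
    (hd : ∀ p ∈ T, ∀ q ∈ T, p ≠ q → (Set.Icc (p.1 l) (p.2 l) ∩ Set.Icc (q.1 l) (q.2 l)).Nonempty →
      Disjoint (E p) (E q))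
    (g : (Fin 2 → ℝ) → ℝ) (hg : Measurable g) (hg0 : ∀ x, 0 ≤ g x)
    (h : ∀ p ∈ T, volume (Set.Icc p.1 p.2) ≤ ∫⁻ x in Set.Icc p.1 p.2, ENNReal.ofReal (g x)) :
    ∑ p ∈ T, volume (Set.Icc p.1 p.2) ≤
      80 * ∫⁻ x in ⋃ p ∈ T, Set.Icc p.1 p.2,
        ENNReal.ofReal (g x * (1 + max 0 (Real.log (g x)))) := by
  obtain ⟨e, he, hex⟩ := exists_measurableEquiv_coords hkl
  have hpre : ∀ p : (Fin 2 → ℝ) × (Fin 2 → ℝ), Set.Icc p.1 p.2 =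
      e ⁻¹' (Set.Icc (p.1 k) (p.2 k) ×ˢ Set.Icc (p.1 l) (p.2 l)) := fun p => by
    rw [Icc_eq_coords hkl]
    ext x
    simp only [Set.mem_preimage, Set.mem_prod, hex, Set.mem_ofPred_eq]
  have hvol : ∀ p : (Fin 2 → ℝ) × (Fin 2 → ℝ), volume (Set.Icc p.1 p.2) =
      volume (Set.Icc (p.1 k) (p.2 k) ×ˢ Set.Icc (p.1 l) (p.2 l)) := fun p => by
    rw [hpre, he.measure_preimage (measurableSet_Icc.prod measurableSet_Icc).nullMeasurableSet]
  have hint : ∀ (s : Set (ℝ × ℝ)) (F : (Fin 2 → ℝ) → ℝ≥0∞),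
      ∫⁻ x in e ⁻¹' s, F x = ∫⁻ z in s, F (e.symm z) := fun s F => by
    rw [← he.setLIntegral_comp_preimage_emb e.measurableEmbedding]
    simp
  have hU : ⋃ p ∈ T, Set.Icc p.1 p.2 =
      e ⁻¹' ⋃ p ∈ T, Set.Icc (p.1 k) (p.2 k) ×ˢ Set.Icc (p.1 l) (p.2 l) := by
    simp only [Set.preimage_iUnion, ← hpre]
  rw [hU, hint]
  simp only [hvol]
  refine sum_volume_prod_le_setLIntegral T (fun p => p.1 k) (fun p => p.2 k)
    (fun p hp => hT p hp k) (fun p => Set.Icc (p.1 l) (p.2 l)) (fun p => measurableSet_Icc)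
    (fun p => by simp) E hE hd (fun z => g (e.symm z)) (hg.comp e.symm.measurable)
    (fun z => hg0 _) fun p hp => ?_
  rw [← hvol, ← hint _ fun x => ENNReal.ofReal (g x), ← hpre]
  exact h p hp

theorem card_image_univ_fin_two_le (s : Fin 2 → ℝ) : (Finset.image s Finset.univ).card ≤ 2 :=
  Finset.card_image_le.trans (by simp)

/-- The weighted estimate for a finite family of rectangles whose shorter side is in the
direction `k`. -/
theorem setLIntegral_biUnion_Icc_le {k l : Fin 2} (hkl : k ≠ l) (w : (Fin 2 → ℝ) → ℝ≥0∞)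
    (g : (Fin 2 → ℝ) → ℝ) (hg : Measurable g) (hg0 : ∀ x, 0 ≤ g x)
    (F : Finset ((Fin 2 → ℝ) × (Fin 2 → ℝ))) (hF : ∀ p ∈ F, ∀ i, p.1 i < p.2 i)
    (hside : ∀ p ∈ F, p.2 k - p.1 k ≤ p.2 l - p.1 l)
    (hav : ∀ p ∈ F, volume (Set.Icc p.1 p.2) ≤
      ∫⁻ x in Set.Icc p.1 p.2, ENNReal.ofReal (g x)) :
    ∫⁻ x in ⋃ p ∈ F, Set.Icc p.1 p.2, w x ≤
      12000 * ∫⁻ x, ENNReal.ofReal (g x * (1 + max 0 (Real.log (g x)))) *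
        strongMaximal 2 2 (strongMaximal 2 1 w) x := by
  classical
  set I : (Fin 2 → ℝ) × (Fin 2 → ℝ) → Set ℝ := fun p => Set.Icc (p.1 k) (p.2 k) with hI
  set J : (Fin 2 → ℝ) × (Fin 2 → ℝ) → Set ℝ := fun p => Set.Icc (p.1 l) (p.2 l) with hJ
  set len : (Fin 2 → ℝ) × (Fin 2 → ℝ) → ℝ := fun p => p.2 l - p.1 l with hlen
  obtain ⟨S, hSF, E, hE, hd, hcov⟩ := exists_sparse_subfamily I J len (fun p => measurableSet_Icc)
    F fun p hp => Set.nonempty_Icc.2 (hF p hp l).le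
  set lo : (Fin 2 → ℝ) × (Fin 2 → ℝ) → Fin 2 → ℝ := fun p =>
    Function.update p.1 l (p.1 l - len p) with hlo
  set hi : (Fin 2 → ℝ) × (Fin 2 → ℝ) → Fin 2 → ℝ := fun p =>
    Function.update p.2 l (p.2 l + len p) with hhi
  have hlok : ∀ p, lo p k = p.1 k := fun p => Function.update_of_ne hkl _ _
  have hhik : ∀ p, hi p k = p.2 k := fun p => Function.update_of_ne hkl _ _
  have hlol : ∀ p, lo p l = p.1 l - len p := fun p => Function.update_self _ _ _
  have hhil : ∀ p, hi p l = p.2 l + len p := fun p => Function.update_self _ _ _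
  have hforall : ∀ P : Fin 2 → Prop, P k → P l → ∀ i, P i := by
    intro P hk hl i
    rcases (by omega : i = k ∨ i = l) with rfl | rfl <;> assumption
  have hlen0 : ∀ p ∈ F, 0 < len p := fun p hp => sub_pos.2 (hF p hp l)
  have hlohi : ∀ p ∈ F, ∀ i, lo p i < hi p i := fun p hp => by
    refine hforall _ ?_ ?_
    · rw [hlok, hhik]; exact hF p hp k
    · rw [hlol, hhil]; linarith [hF p hp l, hlen0 p hp]
  set U := ⋃ q ∈ S, Set.Icc (lo q) (hi q) with hU
  have hUm : MeasurableSet U := Finset.measurableSet_biUnion _ fun q _ => measurableSet_Icc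
  set G : Set ((Fin 2 → ℝ) × ℝ) := {q | 0 < q.2 ∧ ∃ p ∈ F, q.2 = (p.2 k - p.1 k) / 2 ∧
    (∀ y, y ∈ Metric.closedBall q.1 q.2 ↔
      y k ∈ I p ∧ y l ∈ Set.Icc (q.1 l - q.2) (q.1 l + q.2)) ∧
    Set.Icc (q.1 l - q.2) (q.1 l + q.2) ⊆ J p} with hG
  have hcovG : ⋃ p ∈ F, Set.Icc p.1 p.2 ⊆ ⋃ q ∈ G, Metric.closedBall q.1 q.2 := by
    refine Set.iUnion₂_subset fun p hp x hx => ?_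
    set r := (p.2 k - p.1 k) / 2 with hr
    have hr0 : 0 < r := by linarith [hF p hp k]
    have hrl : p.1 l + r ≤ p.2 l - r := by linarith [hside p hp]
    set z : Fin 2 → ℝ := fun i => max (p.1 i + r) (min (x i) (p.2 i - r)) with hz
    have hzk : z k = p.1 k + r := max_eq_left ((min_le_right _ _).trans (by linarith))
    have hmem : ∀ y, y ∈ Metric.closedBall z r ↔
        y k ∈ I p ∧ y l ∈ Set.Icc (z l - r) (z l + r) := by
      intro y
      rw [closedBall_eq_Icc_pi z hr0.le, Icc_eq_coords hkl]
      simp only [Set.mem_ofPred_eq, hI, hzk]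
      rw [show p.1 k + r - r = p.1 k by ring, show p.1 k + r + r = p.2 k by rw [hr]; ring]
    rw [Icc_eq_coords hkl] at hx
    refine Set.mem_biUnion (x := (z, r)) ⟨hr0, p, hp, rfl, hmem, ?_⟩ ((hmem x).2 ⟨hx.1, ?_, ?_⟩)
    · refine Set.Icc_subset_Icc ?_ ?_
      · linarith [le_max_left (p.1 l + r) (min (x l) (p.2 l - r))]
      · have : z l ≤ p.2 l - r := max_le hrl (min_le_right _ _)
        change z l + r ≤ p.2 l
        linarith
    · rw [sub_le_iff_le_add]
      refine max_le ?_ ((min_le_left _ _).trans (by linarith))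
      linarith [hx.2.1]
    · rw [← sub_le_iff_le_add]
      refine le_max_of_le_right (le_min (by linarith) ?_)
      linarith [hx.2.2]
  obtain ⟨R, hR⟩ : ∃ R : ℝ, ∀ q ∈ G, q.2 ≤ R := by
    obtain ⟨R, hR⟩ := (F.finite_toSet.image fun p => (p.2 k - p.1 k) / 2).bddAbove
    exact ⟨R, fun q ⟨_, p, hp, hq, _⟩ => hR ⟨p, hp, hq.symm⟩⟩
  have hhalf : ∀ q ∈ G, volume (Metric.closedBall q.1 q.2) ≤
      2 * volume (Metric.closedBall q.1 q.2 ∩ U) := by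
    rintro q ⟨hq0, p, hp, hqr, hmem, hsub⟩
    set B := ⋃ q ∈ S, ⋃ (_ : (J p ∩ J q).Nonempty ∧ len p ≤ len q), I q with hB
    have hBm : MeasurableSet B :=
      Finset.measurableSet_biUnion _ fun q _ => MeasurableSet.iUnion fun _ => measurableSet_Icc
    have hball : Metric.closedBall q.1 q.2 =
        {y | y k ∈ I p ∧ y l ∈ Set.Icc (q.1 l - q.2) (q.1 l + q.2)} := Set.ext hmem
    have hinter : {y : Fin 2 → ℝ | y k ∈ I p ∩ B ∧ y l ∈ Set.Icc (q.1 l - q.2) (q.1 l + q.2)} ⊆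
        Metric.closedBall q.1 q.2 ∩ U := by
      rintro y ⟨⟨hyI, hyB⟩, hyl⟩
      refine ⟨(hmem y).2 ⟨hyI, hyl⟩, ?_⟩
      simp only [hB, Set.mem_iUnion] at hyB
      obtain ⟨s, hs, ⟨⟨u, hup, hus⟩, hls⟩, hyk⟩ := hyB
      refine Set.mem_biUnion (x := s) hs ?_
      rw [Icc_eq_coords hkl]
      have hyJ := hsub hyl
      simp only [hJ, hI, hlen, Set.mem_Icc] at hup hus hls hyk hyJ
      simp only [Set.mem_ofPred_eq, hlok, hhik, hlol, hhil, hlen, Set.mem_Icc]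
      exact ⟨hyk, by linarith, by linarith⟩
    calc volume (Metric.closedBall q.1 q.2)
        = volume (I p) * volume (Set.Icc (q.1 l - q.2) (q.1 l + q.2)) := by
          rw [hball, volume_coords hkl measurableSet_Icc measurableSet_Icc]
      _ ≤ 2 * volume (I p ∩ B) * volume (Set.Icc (q.1 l - q.2) (q.1 l + q.2)) := by
          gcongr; exact hcov p hp
      _ = 2 * volume {y : Fin 2 → ℝ |
            y k ∈ I p ∩ B ∧ y l ∈ Set.Icc (q.1 l - q.2) (q.1 l + q.2)} := by
          rw [volume_coords hkl (measurableSet_Icc.inter hBm) measurableSet_Icc, mul_assoc]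
      _ ≤ 2 * volume (Metric.closedBall q.1 q.2 ∩ U) := by gcongr
  set v := strongMaximal 2 1 w with hv
  set c : (Fin 2 → ℝ) × (Fin 2 → ℝ) → ℝ≥0∞ := fun p =>
    (∫⁻ x in Set.Icc (lo p) (hi p), v x) / volume (Set.Icc (lo p) (hi p)) with hc
  set Φ : (Fin 2 → ℝ) → ℝ≥0∞ := fun x =>
    80 * ENNReal.ofReal (g x * (1 + max 0 (Real.log (g x)))) with hΦ
  have hΦm : Measurable Φ := by fun_prop
  have hvol3 : ∀ p ∈ F, volume (Set.Icc (lo p) (hi p)) = 3 * volume (Set.Icc p.1 p.2) := by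
    intro p hp
    have h3 : volume (Set.Icc (p.1 l - len p) (p.2 l + len p)) =
        3 * volume (Set.Icc (p.1 l) (p.2 l)) := by
      rw [Real.volume_Icc, Real.volume_Icc, ← ENNReal.ofReal_ofNat 3,
        ← ENNReal.ofReal_mul (by norm_num)]
      congr 1
      simp only [hlen]
      ring
    rw [Icc_eq_coords hkl, Icc_eq_coords hkl p.1, volume_coords hkl measurableSet_Icc
      measurableSet_Icc, volume_coords hkl measurableSet_Icc measurableSet_Icc, hlok, hhik, hlol,
      hhil, h3, mul_left_comm]
  have hcW : ∀ p ∈ S, ∀ x ∈ Set.Icc p.1 p.2, c p ≤ strongMaximal 2 2 v x := by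
    intro p hp x hx
    refine average_le_strongMaximal v (hlohi p (hSF hp)) (card_image_univ_fin_two_le _) ?_
    rw [Icc_eq_coords hkl] at hx ⊢
    simp only [Set.mem_ofPred_eq, hlok, hhik, hlol, hhil]
    have := hlen0 p (hSF hp)
    exact ⟨hx.1, by linarith [hx.2.1], by linarith [hx.2.2]⟩
  have hpack : ∑ p ∈ S, c p * volume (Set.Icc p.1 p.2) ≤
      ∫⁻ x, ⨆ p ∈ S, (Set.Icc p.1 p.2).indicator (fun _ => c p) x ∂(volume.withDensity Φ) := by
    refine sum_mul_le_lintegral_iSup_indicator _ S (fun p => Set.Icc p.1 p.2)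
      (fun p => measurableSet_Icc) (fun p => volume (Set.Icc p.1 p.2)) c fun T hTS => ?_
    have hTF : ∀ p ∈ T, p ∈ F := fun p hp => hSF (hTS hp)
    rw [withDensity_apply _ (Finset.measurableSet_biUnion _ fun p _ => measurableSet_Icc), hΦ,
      lintegral_const_mul' _ _ (by finiteness)]
    exact sum_volume_Icc_le hkl T (fun p hp => hF p (hTF p hp)) E (fun p hp => hE p (hTS hp))
      (fun p hp q hq => hd p (hTS hp) q (hTS hq)) g hg hg0 fun p hp => hav p (hTF p hp)
  calc ∫⁻ x in ⋃ p ∈ F, Set.Icc p.1 p.2, w x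
      ≤ ∫⁻ x in ⋃ q ∈ G, Metric.closedBall q.1 q.2, w x := lintegral_mono_set hcovG
    _ ≤ 50 * ∫⁻ x in U, v x :=
        setLIntegral_biUnion_closedBall_le w G R (fun q hq => hq.1) hR U hUm hhalf
    _ ≤ 50 * ∑ p ∈ S, ∫⁻ x in Set.Icc (lo p) (hi p), v x := by
        gcongr 50 * ?_
        have hsub : U = ⋃ q : S, Set.Icc (lo q) (hi q) := by
          rw [hU]
          exact iSup_subtype'
        rw [hsub]
        refine (lintegral_iUnion_le _ _).trans_eq ?_
        rw [tsum_fintype, Finset.sum_coe_sort S fun p => ∫⁻ x in Set.Icc (lo p) (hi p), v x]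
    _ = 50 * ∑ p ∈ S, c p * (3 * volume (Set.Icc p.1 p.2)) := by
        congr 1
        refine Finset.sum_congr rfl fun p hp => ?_
        rw [← hvol3 p (hSF hp)]
        exact (ENNReal.div_mul_cancel (volume_Icc_ne_zero (hlohi p (hSF hp)))
          (volume_Icc_ne_top _ _)).symm
    _ = 150 * ∑ p ∈ S, c p * volume (Set.Icc p.1 p.2) := by
        rw [Finset.mul_sum, Finset.mul_sum]
        exact Finset.sum_congr rfl fun p _ => by ring
    _ ≤ 150 * ∫⁻ x, ⨆ p ∈ S, (Set.Icc p.1 p.2).indicator (fun _ => c p) x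
          ∂(volume.withDensity Φ) := by gcongr
    _ = 150 * ∫⁻ x, Φ x * ⨆ p ∈ S, (Set.Icc p.1 p.2).indicator (fun _ => c p) x := by
        rw [lintegral_withDensity_eq_lintegral_mul _ hΦm]
        · rfl
        · exact Measurable.biSup _ S.countable_toSet fun p _ =>
            measurable_const.indicator measurableSet_Icc
    _ ≤ 150 * ∫⁻ x, 80 * (ENNReal.ofReal (g x * (1 + max 0 (Real.log (g x)))) *
          strongMaximal 2 2 v x) := by
        gcongr 150 * ?_
        refine lintegral_mono fun x => ?_
        rw [← mul_assoc]
        gcongr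
        refine iSup₂_le fun p hp => ?_
        by_cases hx : x ∈ Set.Icc p.1 p.2
        · rw [Set.indicator_of_mem hx]; exact hcW p hp x hx
        · rw [Set.indicator_of_notMem hx]; exact zero_le
    _ = _ := by
        rw [lintegral_const_mul' _ _ (by finiteness), ← mul_assoc]
        norm_num

theorem exists_enlarged_Icc {k l : Fin 2} (hkl : k ≠ l) {a b : Fin 2 → ℝ}
    {m : ℝ≥0∞} (hm : volume (Set.Icc a b) < m) :
    ∃ ε : ℝ, 0 < ε ∧ volume (Set.Icc (fun i => a i - ε) fun i => b i + ε) < m := by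
  have hvol : ∀ ε : ℝ, volume (Set.Icc (fun i => a i - ε) fun i => b i + ε) =
      ENNReal.ofReal (b k + ε - (a k - ε)) * ENNReal.ofReal (b l + ε - (a l - ε)) := fun ε => by
    rw [Icc_eq_coords hkl, volume_coords hkl measurableSet_Icc measurableSet_Icc,
      Real.volume_Icc, Real.volume_Icc]
  have hcont : ContinuousAt
      (fun ε : ℝ => volume (Set.Icc (fun i => a i - ε) fun i => b i + ε)) 0 := by
    simp only [hvol]
    refine ENNReal.Tendsto.mul ?_ (Or.inr (by finiteness)) ?_ (Or.inr (by finiteness)) <;>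
    · refine ENNReal.tendsto_ofReal (Continuous.tendsto ?_ 0)
      fun_prop
  have hev := hcont.eventually_lt_const (show volume (Set.Icc _ _) < m by simpa using hm)
  obtain ⟨ε, hε, hε0⟩ := ((hev.filter_mono nhdsWithin_le_nhds).and self_mem_nhdsWithin :
    ∀ᶠ ε in nhdsWithin (0 : ℝ) (Set.Ioi 0), _ ∧ ε ∈ Set.Ioi (0 : ℝ)).exists
  exact ⟨ε, hε0, hε⟩

/-- The weighted estimate for the union of all rectangles whose shorter side is in the direction
`k` and on which the average of `g` exceeds one. -/
theorem setLIntegral_iUnion_Icc_le {k l : Fin 2} (hkl : k ≠ l) (w : (Fin 2 → ℝ) → ℝ≥0∞)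
    (g : (Fin 2 → ℝ) → ℝ) (hg : Measurable g) (hg0 : ∀ x, 0 ≤ g x)
    (F : Set ((Fin 2 → ℝ) × (Fin 2 → ℝ)))
    (hF : F = {p | (∀ i, p.1 i < p.2 i) ∧ p.2 k - p.1 k ≤ p.2 l - p.1 l ∧
      volume (Set.Icc p.1 p.2) < ∫⁻ x in Set.Icc p.1 p.2, ENNReal.ofReal (g x)}) :
    ∫⁻ x in ⋃ p ∈ F, Set.Icc p.1 p.2, w x ≤
      12000 * ∫⁻ x, ENNReal.ofReal (g x * (1 + max 0 (Real.log (g x)))) *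
        strongMaximal 2 2 (strongMaximal 2 1 w) x := by
  have hopen : ⋃ p ∈ F, Set.Icc p.1 p.2 ⊆ ⋃ p ∈ F, interior (Set.Icc p.1 p.2) := by
    refine Set.iUnion₂_subset fun p hp x hx => ?_
    rw [hF] at hp
    obtain ⟨ε, hε, hlt⟩ := exists_enlarged_Icc hkl hp.2.2
    refine Set.mem_biUnion (x := (fun i => p.1 i - ε, fun i => p.2 i + ε)) ?_ ?_
    · rw [hF]
      refine ⟨fun i => by linarith [hp.1 i], by linarith [hp.2.1], hlt.trans_le ?_⟩
      exact lintegral_mono_set (Set.Icc_subset_Icc (fun i => by simp [hε.le])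
        fun i => by simp [hε.le])
    · rw [mem_interior]
      refine ⟨Set.univ.pi fun i => Set.Ioo (p.1 i - ε) (p.2 i + ε), fun y hy => ?_,
        isOpen_set_pi Set.finite_univ fun i _ => isOpen_Ioo, fun i _ => ?_⟩
      · exact ⟨fun i => (hy i trivial).1.le, fun i => (hy i trivial).2.le⟩
      · exact ⟨by linarith [hx.1 i], by linarith [hx.2 i]⟩
  obtain ⟨T, hTF, hT, hTU⟩ := TopologicalSpace.isOpen_biUnion_countable F
    (fun p => interior (Set.Icc p.1 p.2)) fun p _ => isOpen_interior
  have hcov : ⋃ p ∈ F, Set.Icc p.1 p.2 ⊆ ⋃ p ∈ T, Set.Icc p.1 p.2 :=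
    (hopen.trans_eq hTU.symm).trans (Set.iUnion₂_mono fun p _ => interior_subset)
  refine (lintegral_mono_set hcov).trans ?_
  have : Countable T := hT
  rw [Set.biUnion_eq_iUnion, Set.iUnion_eq_iUnion_finset,
    ← withDensity_apply _ (MeasurableSet.iUnion fun s => Finset.measurableSet_biUnion _
      fun p _ => measurableSet_Icc), Directed.measure_iUnion]
  · refine iSup_le fun s => ?_
    rw [withDensity_apply _ (Finset.measurableSet_biUnion _ fun p _ => measurableSet_Icc)]
    have hs : ∀ p ∈ s.map (Function.Embedding.subtype (· ∈ T)), p ∈ F := fun p hp => by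
      obtain ⟨q, -, rfl⟩ := Finset.mem_map.1 hp
      exact hTF q.2
    rw [hF] at hs
    have := setLIntegral_biUnion_Icc_le hkl w g hg hg0 (s.map (Function.Embedding.subtype _))
      (fun p hp => (hs p hp).1) (fun p hp => (hs p hp).2.1) fun p hp => (hs p hp).2.2.le
    simpa using this
  · exact Monotone.directed_le fun s t hst => Set.biUnion_subset_biUnion_left hst

/-- The endpoint Fefferman–Stein type `L log L` inequality for the strong maximal operator
in the plane, with the composed weight `W = 𝔐₂ 𝔐 w`. -/
theorem endpoint_fefferman_stein_plane :
    ∃ C : ℝ, 0 < C ∧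
      ∀ w : (Fin 2 → ℝ) → ℝ, (∀ x, 0 ≤ w x) → LocallyIntegrable w →
      ∀ f : (Fin 2 → ℝ) → ℝ, LocallyIntegrable f →
      ∀ t : ℝ, 0 < t →
        (∫⁻ x in {x | ENNReal.ofReal t <
              strongMaximal 2 2 (fun y => ENNReal.ofReal |f y|) x},
            ENNReal.ofReal (w x))
          ≤ ENNReal.ofReal C *
            ∫⁻ x, ENNReal.ofReal
                ((|f x| / t) * (1 + max 0 (Real.log (|f x| / t)))) *
              strongMaximal 2 2 (strongMaximal 2 1 (fun y => ENNReal.ofReal (w y))) x := by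
  refine ⟨24000, by norm_num, fun w hw _ f hf t ht => ?_⟩
  obtain ⟨f', hf'm, hff'⟩ := hf.aestronglyMeasurable
  set v : (Fin 2 → ℝ) → ℝ≥0∞ := fun y => ENNReal.ofReal (w y)
  set g : (Fin 2 → ℝ) → ℝ := fun x => |f' x| / t with hg
  have hgm : Measurable g := by
    have := hf'm.measurable
    fun_prop
  have hg0 : ∀ x, 0 ≤ g x := fun x => by positivity
  set A := ∫⁻ x, ENNReal.ofReal (g x * (1 + max 0 (Real.log (g x)))) *
    strongMaximal 2 2 (strongMaximal 2 1 v) x with hA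
  have hRHS : ∫⁻ x, ENNReal.ofReal ((|f x| / t) * (1 + max 0 (Real.log (|f x| / t)))) *
      strongMaximal 2 2 (strongMaximal 2 1 v) x = A :=
    lintegral_congr_ae <| hff'.mono fun x hx => by simp only [hx, hg]
  rw [hRHS]
  set F : Fin 2 → Fin 2 → Set ((Fin 2 → ℝ) × (Fin 2 → ℝ)) := fun k l =>
    {p | (∀ i, p.1 i < p.2 i) ∧ p.2 k - p.1 k ≤ p.2 l - p.1 l ∧
      volume (Set.Icc p.1 p.2) < ∫⁻ x in Set.Icc p.1 p.2, ENNReal.ofReal (g x)} with hF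
  have hcov : {x | ENNReal.ofReal t < strongMaximal 2 2 (fun y => ENNReal.ofReal |f y|) x} ⊆
      (⋃ p ∈ F 0 1, Set.Icc p.1 p.2) ∪ ⋃ p ∈ F 1 0, Set.Icc p.1 p.2 := by
    intro x hx
    simp only [Set.mem_ofPred_eq, strongMaximal, lt_iSup_iff] at hx
    obtain ⟨a, b, hab, -, hxab, hlt⟩ := hx
    have hav : volume (Set.Icc a b) < ∫⁻ x in Set.Icc a b, ENNReal.ofReal (g x) := by
      have hint : ∫⁻ x in Set.Icc a b, ENNReal.ofReal (g x) =
          (∫⁻ x in Set.Icc a b, ENNReal.ofReal |f x|) / ENNReal.ofReal t := by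
        simp only [hg, ENNReal.ofReal_div_of_pos ht]
        simp only [div_eq_mul_inv]
        rw [lintegral_mul_const' _ _ (by simpa using ht)]
        congr 1
        exact lintegral_congr_ae <| ae_restrict_of_ae <| hff'.mono fun x hx => by simp only [hx]
      rw [hint, ENNReal.lt_div_iff_mul_lt (Or.inl (by simpa using ht)) (Or.inl (by finiteness)),
        mul_comm]
      exact (ENNReal.lt_div_iff_mul_lt (Or.inl (volume_Icc_ne_zero hab))
        (Or.inl (volume_Icc_ne_top _ _))).1 hlt
    rcases le_total (b 0 - a 0) (b 1 - a 1) with h | h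
    · exact Or.inl (Set.mem_biUnion (x := (a, b)) ⟨hab, h, hav⟩ hxab)
    · exact Or.inr (Set.mem_biUnion (x := (a, b)) ⟨hab, h, hav⟩ hxab)
  calc ∫⁻ x in {x | ENNReal.ofReal t < strongMaximal 2 2 (fun y => ENNReal.ofReal |f y|) x}, v x
      ≤ ∫⁻ x in (⋃ p ∈ F 0 1, Set.Icc p.1 p.2) ∪ ⋃ p ∈ F 1 0, Set.Icc p.1 p.2, v x :=
        lintegral_mono_set hcov
    _ ≤ 12000 * A + 12000 * A := (lintegral_union_le _ _ _).trans <| add_le_add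
        (setLIntegral_iUnion_Icc_le (by decide) v g hgm hg0 _ rfl)
        (setLIntegral_iUnion_Icc_le (by decide) v g hgm hg0 _ rfl)
    _ = ENNReal.ofReal 24000 * A := by
        rw [← add_mul]
        norm_num
end

section
/- Let m ≥ 2 be an integer and define φ(a) = ∫₀^a exp(s^{1/(m−1)}) ds for a ≥ 0. Then for all a, b > 0 one has a·b ≤ φ(a) + b (log⁺ b)^{m−1}, where log⁺ b = max(0, log b). -/
/-- A Young type inequality: with `φ(a) = ∫₀^a exp(s^{1/(m-1)}) ds`, one has
`a·b ≤ φ(a) + b (log⁺ b)^{m-1}` for all `a, b > 0`. -/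
theorem young_type_inequality_exp_rpow
    (m : ℕ) (hm : 2 ≤ m) (a b : ℝ) (ha : 0 < a) (hb : 0 < b) :
    a * b ≤ (∫ s in (0:ℝ)..a, Real.exp (s ^ (1 / ((m : ℝ) - 1)))) +
      b * (max 0 (Real.log b)) ^ (m - 1) := by
  have hexp : 1 / ((m : ℝ) - 1) = ((m - 1 : ℕ) : ℝ)⁻¹ := by
    rw [Nat.cast_sub (by omega), Nat.cast_one, one_div]
  rw [hexp]
  set L := max 0 (Real.log b)
  have hL : 0 ≤ L := le_max_left _ _
  have hc : 0 ≤ L ^ (m - 1) := pow_nonneg hL _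
  have hcont : Continuous fun s : ℝ => Real.exp (s ^ ((m - 1 : ℕ) : ℝ)⁻¹) :=
    Real.continuous_exp.comp (Real.continuous_rpow_const (by positivity))
  have hint (x y : ℝ) := hcont.intervalIntegrable (μ := MeasureTheory.volume) x y
  rcases le_total a (L ^ (m - 1)) with hac | hca
  · have hφ : 0 ≤ ∫ s in (0:ℝ)..a, Real.exp (s ^ ((m - 1 : ℕ) : ℝ)⁻¹) :=
      intervalIntegral.integral_nonneg ha.le fun s _ => (Real.exp_pos _).le
    nlinarith
  · have hφ : 0 ≤ ∫ s in (0:ℝ)..(L ^ (m - 1)), Real.exp (s ^ ((m - 1 : ℕ) : ℝ)⁻¹) :=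
      intervalIntegral.integral_nonneg hc fun s _ => (Real.exp_pos _).le
    have htail : ∫ _ in (L ^ (m - 1))..a, b ≤
        ∫ s in (L ^ (m - 1))..a, Real.exp (s ^ ((m - 1 : ℕ) : ℝ)⁻¹) := by
      refine intervalIntegral.integral_mono_on hca intervalIntegrable_const (hint _ _) ?_
      intro s hs
      have hLs : L ≤ s ^ ((m - 1 : ℕ) : ℝ)⁻¹ := by
        rw [← Real.pow_rpow_inv_natCast hL (show m - 1 ≠ 0 by omega)]
        exact Real.rpow_le_rpow hc hs.1 (by positivity)
      exact (Real.log_le_iff_le_exp hb).mp ((le_max_right _ _).trans hLs)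
    rw [intervalIntegral.integral_const, smul_eq_mul] at htail
    rw [← intervalIntegral.integral_add_adjacent_intervals (hint 0 (L ^ (m - 1))) (hint _ a)]
    linarith
end

section
/- Let d ≥ 1, let m be an integer with 1 ≤ m ≤ d, and let p > 1. Let U be a weight on ℝ^d and set W = 𝔐_m U. Let R̃₁, …, R̃_N be rectangles in ℝ^d of complexity m and let E₁, …, E_N be pairwise disjoint measurable sets with E_i ⊆ R̃_i and |E_i| ≥ (1/2)|R̃_i| for each i. Then there is a constant C > 0, depending only on d, m and p, such that for every locally integrable f, ∑_{i=1}^N U(R̃_i) · ((1/|R̃_i|)∫_{R̃_i} |f| dy)^p ≤ C ∫_{ℝ^d} |f|^p W dx. -/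
open MeasureTheory ENNReal

theorem lintegral_rpow_Ioo {s : ℝ} (hs : 0 < s) {b : ℝ} (hb : 0 ≤ b) :
    ∫⁻ t in Set.Ioo 0 b, ENNReal.ofReal (t ^ (s - 1)) = ENNReal.ofReal (b ^ s / s) := by
  have hint : IntervalIntegrable (fun t : ℝ => t ^ (s - 1)) volume 0 b :=
    intervalIntegral.intervalIntegrable_rpow' (by linarith)
  have hval : ∫ t in (0 : ℝ)..b, t ^ (s - 1) = b ^ s / s := by
    rw [integral_rpow (Or.inl (by linarith)), sub_add_cancel, Real.zero_rpow hs.ne', sub_zero]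
  rw [← hval, intervalIntegral.integral_of_le hb, restrict_Ioo_eq_restrict_Ioc,
    ofReal_integral_eq_lintegral_ofReal hint.1]
  filter_upwards [ae_restrict_mem measurableSet_Ioc] with t ht
  exact Real.rpow_nonneg ht.1.le _

/-- The layer cake integral of a power, for a possibly infinite height `y`. -/
theorem lintegral_Ioi_indicator_rpow {s : ℝ} (hs : 0 < s) (y : ℝ≥0∞) :
    ∫⁻ t in Set.Ioi (0 : ℝ),
      {t : ℝ | ENNReal.ofReal t < y}.indicator (fun t => ENNReal.ofReal (t ^ (s - 1))) t
      = y ^ s / ENNReal.ofReal s := by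
  have hm (y : ℝ≥0∞) : MeasurableSet {t : ℝ | ENNReal.ofReal t < y} :=
    measurableSet_lt ENNReal.measurable_ofReal measurable_const
  have key (b : ℝ) (hb : 0 ≤ b) : ∫⁻ t in Set.Ioi (0 : ℝ),
      {t : ℝ | ENNReal.ofReal t < ENNReal.ofReal b}.indicator
        (fun t => ENNReal.ofReal (t ^ (s - 1))) t = ENNReal.ofReal b ^ s / ENNReal.ofReal s := by
    rw [lintegral_indicator (hm _), Measure.restrict_restrict (hm _)]
    have : {t : ℝ | ENNReal.ofReal t < ENNReal.ofReal b} ∩ Set.Ioi 0 = Set.Ioo 0 b := by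
      ext t
      simp only [Set.mem_inter_iff, Set.mem_ofPred_eq, Set.mem_Ioi, Set.mem_Ioo]
      constructor
      · rintro ⟨h, h0⟩
        exact ⟨h0, (ENNReal.ofReal_lt_ofReal_iff_of_nonneg h0.le).1 h⟩
      · rintro ⟨h0, h⟩
        exact ⟨(ENNReal.ofReal_lt_ofReal_iff_of_nonneg h0.le).2 h, h0⟩
    rw [this, lintegral_rpow_Ioo hs hb, ENNReal.ofReal_div_of_pos hs,
      ENNReal.ofReal_rpow_of_nonneg hb hs.le]
  by_cases hy : y = ⊤
  · subst hy
    rw [ENNReal.top_rpow_of_pos hs, ENNReal.top_div_of_ne_top ENNReal.ofReal_ne_top]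
    have hlim : Filter.Tendsto (fun n : ℕ => ENNReal.ofReal ((n : ℝ) ^ s / s)) Filter.atTop
        (nhds ⊤) :=
      ENNReal.tendsto_ofReal_atTop.comp
        (((tendsto_rpow_atTop hs).comp tendsto_natCast_atTop_atTop).atTop_div_const hs)
    refine top_le_iff.1 (le_of_tendsto' hlim fun n => ?_)
    rw [ENNReal.ofReal_div_of_pos hs, ← ENNReal.ofReal_rpow_of_nonneg n.cast_nonneg hs.le,
      ← key n n.cast_nonneg]
    refine lintegral_mono fun t => Set.indicator_le_indicator_of_subset ?_ (by simp) t
    intro t _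
    exact ENNReal.ofReal_lt_top
  · rw [← ENNReal.ofReal_toReal hy]
    exact key _ ENNReal.toReal_nonneg

/-- Marcinkiewicz interpolation between `L^∞` and weak `L¹`, with both endpoint estimates encoded in
`hweak`. -/
theorem lintegral_rpow_le_of_weak_type {α : Type*} [MeasurableSpace α] {μ : Measure α} [SFinite μ]
    {p : ℝ} (hp : 1 < p) {A : ℝ} (hA : 0 ≤ A) {F g : α → ℝ≥0∞}
    (hF : Measurable F) (hg : Measurable g)
    (hweak : ∀ t : ℝ, 0 < t → ENNReal.ofReal t * μ {x | ENNReal.ofReal t < F x} ≤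
      ENNReal.ofReal A * ∫⁻ x in {x | ENNReal.ofReal t < 2 * g x}, g x ∂μ) :
    ∫⁻ x, F x ^ p ∂μ ≤
      ENNReal.ofReal (p * A * (2 ^ (p - 1) / (p - 1))) * ∫⁻ x, g x ^ p ∂μ := by
  have hp0 : 0 < p := by linarith
  have hp1 : 0 < p - 1 := by linarith
  have hset {G : α → ℝ≥0∞} (hG : Measurable G) :
      MeasurableSet {z : α × ℝ | ENNReal.ofReal z.2 < G z.1} :=
    measurableSet_lt (by fun_prop) (by fun_prop)
  have hmF (t : ℝ) : MeasurableSet {x | ENNReal.ofReal t < F x} :=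
    measurableSet_lt measurable_const hF
  have hmg (t : ℝ) : MeasurableSet {x | ENNReal.ofReal t < 2 * g x} :=
    measurableSet_lt measurable_const (by fun_prop)
  have hpt (x : α) : F x ^ p = ENNReal.ofReal p * ∫⁻ t in Set.Ioi (0 : ℝ),
      {t : ℝ | ENNReal.ofReal t < F x}.indicator (fun t => ENNReal.ofReal (t ^ (p - 1))) t := by
    rw [lintegral_Ioi_indicator_rpow hp0,
      ENNReal.mul_div_cancel (by simpa using hp0) ENNReal.ofReal_ne_top]
  have hpt' (x : α) : ∫⁻ t in Set.Ioi (0 : ℝ), g x *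
      {t : ℝ | ENNReal.ofReal t < 2 * g x}.indicator
        (fun t => ENNReal.ofReal (t ^ (p - 1 - 1))) t
      = ENNReal.ofReal (2 ^ (p - 1) / (p - 1)) * g x ^ p := by
    rw [lintegral_const_mul _ (Measurable.indicator (by fun_prop)
        (measurableSet_lt ENNReal.measurable_ofReal measurable_const)),
      lintegral_Ioi_indicator_rpow hp1, ENNReal.mul_rpow_of_nonneg _ _ hp1.le,
      ENNReal.ofReal_div_of_pos hp1, ← ENNReal.ofReal_rpow_of_pos two_pos, ENNReal.ofReal_ofNat]
    have : g x ^ p = g x * g x ^ (p - 1) := by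
      conv_lhs => rw [show p = 1 + (p - 1) by ring]
      rw [ENNReal.rpow_add_of_nonneg _ _ zero_le_one hp1.le, ENNReal.rpow_one]
    rw [this, div_eq_mul_inv, div_eq_mul_inv]
    ring
  have hmeasF : Measurable (Function.uncurry fun (x : α) (t : ℝ) =>
      {t : ℝ | ENNReal.ofReal t < F x}.indicator (fun t => ENNReal.ofReal (t ^ (p - 1))) t) := by
    have : Measurable fun z : α × ℝ => ENNReal.ofReal (z.2 ^ (p - 1)) := by fun_prop
    exact this.indicator (hset hF)
  have hmeasg : Measurable (Function.uncurry fun (x : α) (t : ℝ) => g x *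
      {t : ℝ | ENNReal.ofReal t < 2 * g x}.indicator
        (fun t => ENNReal.ofReal (t ^ (p - 1 - 1))) t) := by
    have : Measurable fun z : α × ℝ => ENNReal.ofReal (z.2 ^ (p - 1 - 1)) := by fun_prop
    exact (hg.comp measurable_fst).mul (this.indicator (hset (hg.const_mul 2)))
  calc ∫⁻ x, F x ^ p ∂μ
      = ENNReal.ofReal p * ∫⁻ x, (∫⁻ t in Set.Ioi (0 : ℝ),
          {t : ℝ | ENNReal.ofReal t < F x}.indicator
            (fun t => ENNReal.ofReal (t ^ (p - 1))) t) ∂μ := by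
        simp_rw [hpt]
        exact lintegral_const_mul' _ _ ENNReal.ofReal_ne_top
    _ = ENNReal.ofReal p * ∫⁻ t in Set.Ioi (0 : ℝ), (∫⁻ x,
          {t : ℝ | ENNReal.ofReal t < F x}.indicator
            (fun t => ENNReal.ofReal (t ^ (p - 1))) t ∂μ) := by
        rw [lintegral_lintegral_swap hmeasF.aemeasurable]
    _ ≤ ENNReal.ofReal p * ∫⁻ t in Set.Ioi (0 : ℝ), (ENNReal.ofReal A * ∫⁻ x, g x *
          {t : ℝ | ENNReal.ofReal t < 2 * g x}.indicator
            (fun t => ENNReal.ofReal (t ^ (p - 1 - 1))) t ∂μ) := by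
        gcongr ENNReal.ofReal p * ?_
        refine setLIntegral_mono' measurableSet_Ioi fun t (ht : 0 < t) => ?_
        have h1 : ∫⁻ x, {t : ℝ | ENNReal.ofReal t < F x}.indicator
            (fun t => ENNReal.ofReal (t ^ (p - 1))) t ∂μ
            = ENNReal.ofReal (t ^ (p - 1)) * μ {x | ENNReal.ofReal t < F x} := by
          rw [← lintegral_indicator_const (hmF t)]
          rfl
        have h2 : ∫⁻ x, g x * {t : ℝ | ENNReal.ofReal t < 2 * g x}.indicator
            (fun t => ENNReal.ofReal (t ^ (p - 1 - 1))) t ∂μ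
            = ENNReal.ofReal (t ^ (p - 1 - 1)) *
              ∫⁻ x in {x | ENNReal.ofReal t < 2 * g x}, g x ∂μ := by
          rw [← lintegral_const_mul' _ _ ENNReal.ofReal_ne_top, ← lintegral_indicator (hmg t)]
          refine lintegral_congr fun x => ?_
          by_cases hx : ENNReal.ofReal t < 2 * g x <;> simp [Set.indicator, hx, mul_comm (g x)]
        have h3 : ENNReal.ofReal (t ^ (p - 1)) = ENNReal.ofReal (t ^ (p - 1 - 1)) *
            ENNReal.ofReal t := by
          rw [← ENNReal.ofReal_mul (by positivity), Real.rpow_sub_one ht.ne' (p - 1),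
            div_mul_cancel₀ _ ht.ne']
        rw [h1, h2, h3, mul_assoc, mul_left_comm (ENNReal.ofReal A)]
        exact mul_le_mul_right (hweak t ht) _
    _ = ENNReal.ofReal p * (ENNReal.ofReal A * ∫⁻ x, (∫⁻ t in Set.Ioi (0 : ℝ), g x *
          {t : ℝ | ENNReal.ofReal t < 2 * g x}.indicator
            (fun t => ENNReal.ofReal (t ^ (p - 1 - 1))) t) ∂μ) := by
        rw [lintegral_const_mul' _ _ ENNReal.ofReal_ne_top,
          lintegral_lintegral_swap hmeasg.aemeasurable]
    _ = _ := by
        simp_rw [hpt']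
        rw [lintegral_const_mul' _ _ ENNReal.ofReal_ne_top, ENNReal.ofReal_mul (by positivity),
          ENNReal.ofReal_mul hp0.le, mul_assoc, mul_assoc]

/-- Weak-type estimate for the maximal function over a finite family of intervals, in terms of the
part of `g` above half the level. -/
theorem maximal_weak_type {ι : Type*} [Finite ι] {a b : ι → ℝ} (hab : ∀ i, a i < b i)
    {g : ℝ → ℝ≥0∞} (hg : Measurable g) (t : ℝ) :
    ENNReal.ofReal t * volume {x | ENNReal.ofReal t < ⨆ i, (Set.Icc (a i) (b i)).indicator
        (fun _ => (∫⁻ y in Set.Icc (a i) (b i), g y) / ENNReal.ofReal (b i - a i)) x} ≤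
      ENNReal.ofReal 10 * ∫⁻ x in {x | ENNReal.ofReal t < 2 * g x}, g x := by
  set T : Set ℝ := {x | ENNReal.ofReal t < 2 * g x} with hT
  have hTm : MeasurableSet T := measurableSet_lt measurable_const (by fun_prop)
  set I : Set ι := {i | ENNReal.ofReal t * ENNReal.ofReal (b i - a i) <
    ∫⁻ y in Set.Icc (a i) (b i), g y} with hI
  have hball (i : ι) : Metric.closedBall ((a i + b i) / 2) ((b i - a i) / 2)
      = Set.Icc (a i) (b i) := (Real.Icc_eq_closedBall _ _).symm
  have hlarge (i : ι) (hi : i ∈ I) : ENNReal.ofReal t * ENNReal.ofReal (b i - a i) ≤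
      2 * ∫⁻ y in Set.Icc (a i) (b i) ∩ T, g y := by
    have hle : ∫⁻ y in Set.Icc (a i) (b i), g y ≤ (∫⁻ y in Set.Icc (a i) (b i) ∩ T, g y) +
        ENNReal.ofReal t * ENNReal.ofReal (b i - a i) / 2 := by
      rw [← lintegral_inter_add_sdiff g (Set.Icc (a i) (b i)) hTm]
      gcongr
      calc ∫⁻ y in Set.Icc (a i) (b i) \ T, g y
          ≤ ∫⁻ y in Set.Icc (a i) (b i) \ T, ENNReal.ofReal t / 2 := by
            refine setLIntegral_mono' (measurableSet_Icc.diff hTm) fun y hy => ?_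
            rw [ENNReal.le_div_iff_mul_le (by simp) (by simp), mul_comm]
            exact not_lt.1 hy.2
        _ ≤ ENNReal.ofReal t / 2 * volume (Set.Icc (a i) (b i)) := by
            rw [setLIntegral_const]
            gcongr
            exact Set.sdiff_subset
        _ = _ := by
            rw [Real.volume_Icc, div_eq_mul_inv, div_eq_mul_inv]
            ring
    set L := ENNReal.ofReal t * ENNReal.ofReal (b i - a i) with hL
    have hLtop : L ≠ ⊤ := by finiteness
    have h2 : L / 2 + L / 2 ≤ (∫⁻ y in Set.Icc (a i) (b i) ∩ T, g y) + L / 2 := by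
      rw [ENNReal.add_halves]
      exact hi.le.trans hle
    have h3 : L / 2 ≤ ∫⁻ y in Set.Icc (a i) (b i) ∩ T, g y :=
      (ENNReal.add_le_add_iff_right (ENNReal.div_ne_top hLtop (by simp))).1 h2
    rw [mul_comm]
    exact (ENNReal.div_le_iff (by simp) (by simp)).1 h3
  obtain ⟨R, hR⟩ := (Set.finite_range fun i => (b i - a i) / 2).bddAbove
  obtain ⟨u, huI, hdisj, hcov⟩ := Vitali.exists_disjoint_subfamily_covering_enlargement_closedBall
    I (fun i => (a i + b i) / 2) (fun i => (b i - a i) / 2) R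
    (fun i _ => hR ⟨i, rfl⟩) 5 (by norm_num)
  simp only [hball] at hdisj hcov
  have hsub : {x | ENNReal.ofReal t < ⨆ i, (Set.Icc (a i) (b i)).indicator
        (fun _ => (∫⁻ y in Set.Icc (a i) (b i), g y) / ENNReal.ofReal (b i - a i)) x} ⊆
      ⋃ j ∈ u, Metric.closedBall ((a j + b j) / 2) (5 * ((b j - a j) / 2)) := by
    intro x hx
    obtain ⟨i, hi⟩ := lt_iSup_iff.1 (Set.mem_ofPred_eq ▸ hx)
    have hxi : x ∈ Set.Icc (a i) (b i) := by
      by_contra h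
      simp [h] at hi
    rw [Set.indicator_of_mem hxi] at hi
    have hiI : i ∈ I := by
      rw [ENNReal.lt_div_iff_mul_lt (by simp [hab]) (by simp)] at hi
      exact hi
    obtain ⟨j, hj, hij⟩ := hcov i hiI
    exact Set.mem_biUnion hj (hij hxi)
  have huf : u.Finite := Set.toFinite u
  calc _ ≤ ENNReal.ofReal t * volume
          (⋃ j ∈ u, Metric.closedBall ((a j + b j) / 2) (5 * ((b j - a j) / 2))) := by
        gcongr
    _ ≤ ENNReal.ofReal t * ∑ j ∈ huf.toFinset, 5 * ENNReal.ofReal (b j - a j) := by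
        gcongr
        have := measure_biUnion_finset_le (μ := volume) huf.toFinset
          fun j => Metric.closedBall ((a j + b j) / 2) (5 * ((b j - a j) / 2))
        simp only [Set.Finite.mem_toFinset] at this
        refine this.trans (Finset.sum_le_sum fun j _ => ?_)
        rw [Real.volume_closedBall, show 2 * (5 * ((b j - a j) / 2)) = 5 * (b j - a j) by ring,
          ENNReal.ofReal_mul (by norm_num), ENNReal.ofReal_ofNat]
    _ = 5 * ∑ j ∈ huf.toFinset, ENNReal.ofReal t * ENNReal.ofReal (b j - a j) := by
        simp_rw [Finset.mul_sum]
        exact Finset.sum_congr rfl fun _ _ => by ring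
    _ ≤ 5 * ∑ j ∈ huf.toFinset, 2 * ∫⁻ y in Set.Icc (a j) (b j) ∩ T, g y := by
        refine mul_le_mul_right (Finset.sum_le_sum fun j hj => ?_) _
        exact hlarge j (huI (by simpa using hj))
    _ = ENNReal.ofReal 10 * ∫⁻ y in ⋃ j ∈ huf.toFinset, Set.Icc (a j) (b j) ∩ T, g y := by
        rw [lintegral_biUnion_finset _ (fun j _ => measurableSet_Icc.inter hTm), ← Finset.mul_sum,
          ← mul_assoc]
        · norm_num
        · simp only [Set.Finite.coe_toFinset]
          exact hdisj.mono fun j => Set.inter_subset_left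
    _ ≤ _ := by
        gcongr
        exact Set.iUnion₂_subset fun j _ => Set.inter_subset_right

/-- `L^p` bound on the line for the maximal function over a finite family of intervals, with a
constant that does not depend on the family. -/
theorem lintegral_maximal_rpow_le {ι : Type*} [Finite ι] {a b : ι → ℝ} (hab : ∀ i, a i < b i)
    {p : ℝ} (hp : 1 < p) {g : ℝ → ℝ≥0∞} (hg : Measurable g) :
    ∫⁻ x, (⨆ i, (Set.Icc (a i) (b i)).indicator
        (fun _ => (∫⁻ y in Set.Icc (a i) (b i), g y) / ENNReal.ofReal (b i - a i)) x) ^ p ≤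
      ENNReal.ofReal (p * 10 * (2 ^ (p - 1) / (p - 1))) * ∫⁻ x, g x ^ p :=
  lintegral_rpow_le_of_weak_type hp (by norm_num)
    (.iSup fun _ => measurable_const.indicator measurableSet_Icc) hg
    fun t _ => maximal_weak_type hab hg t

/-- Iterating one-dimensional maximal functions over the coordinates in `s` gives a function that
dominates all partial averages of `g` and is bounded in `L^p` by `g`. -/
theorem exists_dominating_partial_averages {κ ι : Type*} [Fintype κ] [DecidableEq κ] [Finite ι]
    {a b : ι → κ → ℝ} (hab : ∀ i l, a i l < b i l) {p : ℝ} (hp : 1 < p)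
    {g : (κ → ℝ) → ℝ≥0∞} (hg : Measurable g) (s : Finset κ) :
    ∃ h : (κ → ℝ) → ℝ≥0∞, Measurable h ∧
      ∫⁻ x, h x ^ p ≤
        ENNReal.ofReal (p * 10 * (2 ^ (p - 1) / (p - 1))) ^ s.card * ∫⁻ x, g x ^ p ∧
      ∀ i, ∀ x ∈ Set.Icc (a i) (b i),
        (∫⋯∫⁻_s, g ∂(fun l => volume.restrict (Set.Icc (a i l) (b i l)))) x ≤
          (∏ l ∈ s, ENNReal.ofReal (b i l - a i l)) * h x := by
  induction s using Finset.induction_on with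
  | empty => exact ⟨g, hg, by simp, by simp⟩
  | insert l s hl ih =>
    obtain ⟨h, hm, hint, hdom⟩ := ih
    have hmu : Measurable fun z : (κ → ℝ) × ℝ => h (Function.update z.1 l z.2) := by
      refine hm.comp ?_
      fun_prop
    set H : (κ → ℝ) → ℝ≥0∞ := fun x => ⨆ i, (Set.Icc (a i l) (b i l)).indicator
      (fun _ => (∫⁻ y in Set.Icc (a i l) (b i l), h (Function.update x l y)) /
        ENNReal.ofReal (b i l - a i l)) (x l) with hH
    have hHm : Measurable H := by
      refine .iSup fun i => ?_
      have h1 : Measurable fun x => (∫⁻ y in Set.Icc (a i l) (b i l),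
          h (Function.update x l y)) / ENNReal.ofReal (b i l - a i l) :=
        (Measurable.lintegral_prod_right hmu).div_const _
      exact h1.indicator (s := (fun x : κ → ℝ => x l) ⁻¹' Set.Icc (a i l) (b i l))
        (measurable_pi_apply l measurableSet_Icc)
    refine ⟨H, hHm, ?_, fun i x hx => ?_⟩
    · rw [Finset.card_insert_of_notMem hl, pow_succ', mul_assoc]
      refine le_trans ?_ (mul_le_mul_right hint _)
      rw [← lintegral_const_mul' _ _ ENNReal.ofReal_ne_top]
      refine lintegral_le_of_lmarginal_le {l} (hHm.pow_const p) ((hm.pow_const p).const_mul _) ?_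
      intro x
      rw [lmarginal_singleton, lmarginal_singleton]
      have := lintegral_maximal_rpow_le (a := fun i => a i l) (b := fun i => b i l)
        (fun i => hab i l) hp (hmu.comp (measurable_prodMk_left (x := x)))
      rw [← lintegral_const_mul' _ _ ENNReal.ofReal_ne_top] at this
      simpa [hH] using this
    · rw [lmarginal_insert _ hg hl, Finset.prod_insert hl]
      have hxl : x l ∈ Set.Icc (a i l) (b i l) := ⟨hx.1 l, hx.2 l⟩
      have hpos : 0 < ENNReal.ofReal (b i l - a i l) := by simp [hab]
      calc _ ≤ ∫⁻ y in Set.Icc (a i l) (b i l),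
            (∏ l ∈ s, ENNReal.ofReal (b i l - a i l)) * h (Function.update x l y) := by
            refine setLIntegral_mono' measurableSet_Icc fun y hy => hdom i _ ?_
            rw [← Set.pi_univ_Icc] at hx ⊢
            intro j hj
            by_cases hjl : j = l
            · subst hjl
              simpa using hy
            · simpa [hjl] using hx j hj
        _ = (∏ l ∈ s, ENNReal.ofReal (b i l - a i l)) *
            ∫⁻ y in Set.Icc (a i l) (b i l), h (Function.update x l y) :=
            lintegral_const_mul' _ _ (ENNReal.prod_ne_top fun _ _ => ENNReal.ofReal_ne_top)
        _ ≤ (∏ l ∈ s, ENNReal.ofReal (b i l - a i l)) *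
            (ENNReal.ofReal (b i l - a i l) * H x) := by
            gcongr
            rw [mul_comm, ← ENNReal.div_le_iff hpos.ne' ENNReal.ofReal_ne_top]
            refine le_iSup_of_le i ?_
            rw [Set.indicator_of_mem hxl]
        _ = _ := by ring

/-- The unweighted Carleson embedding for a sparse family of rectangles. -/
theorem sum_volume_mul_average_rpow_le {κ ι : Type*} [Fintype κ] [Fintype ι]
    {a b : ι → κ → ℝ} (hab : ∀ i l, a i l < b i l) {p : ℝ} (hp : 1 < p)
    {E : ι → Set (κ → ℝ)} (hE : ∀ i, MeasurableSet (E i))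
    (hdisj : Pairwise (Function.onFun Disjoint E)) (hsub : ∀ i, E i ⊆ Set.Icc (a i) (b i))
    (hvol : ∀ i, volume (Set.Icc (a i) (b i)) ≤ 2 * volume (E i))
    {g : (κ → ℝ) → ℝ≥0∞} (hg : Measurable g) :
    ∑ i, volume (Set.Icc (a i) (b i)) *
        ((∫⁻ y in Set.Icc (a i) (b i), g y) / volume (Set.Icc (a i) (b i))) ^ p ≤
      2 * ENNReal.ofReal (p * 10 * (2 ^ (p - 1) / (p - 1))) ^ Fintype.card κ *
        ∫⁻ x, g x ^ p := by
  classical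
  obtain ⟨h, hm, hint, hdom⟩ := exists_dominating_partial_averages hab hp hg Finset.univ
  have havg (i : ι) (x) (hx : x ∈ Set.Icc (a i) (b i)) :
      (∫⁻ y in Set.Icc (a i) (b i), g y) / volume (Set.Icc (a i) (b i)) ≤ h x := by
    refine ENNReal.div_le_of_le_mul' ?_
    rw [Real.volume_Icc_pi]
    refine le_trans (le_of_eq ?_) (hdom i x hx)
    rw [← lintegral_eq_lmarginal_univ, ← Measure.restrict_pi_pi, Set.pi_univ_Icc, volume_pi]
  calc _ ≤ ∑ i, 2 * ∫⁻ x in E i, h x ^ p := by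
        refine Finset.sum_le_sum fun i _ => ?_
        refine (mul_le_mul_left (hvol i) _).trans ?_
        rw [mul_assoc]
        gcongr 2 * ?_
        rw [mul_comm, ← setLIntegral_const]
        refine setLIntegral_mono' (hE i) fun x hx => ?_
        gcongr
        exact havg i x (hsub i hx)
    _ = 2 * ∫⁻ x in ⋃ i ∈ Finset.univ, E i, h x ^ p := by
        rw [lintegral_biUnion_finset (fun i _ j _ hij => hdisj hij) (fun i _ => hE i),
          Finset.mul_sum]
    _ ≤ 2 * ∫⁻ x, h x ^ p := by
        gcongr
        exact Measure.restrict_le_self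
    _ ≤ _ := by
        rw [mul_assoc]
        exact mul_le_mul_right hint _

/-- For a sparse family of rectangles `R̃ᵢ = [aᵢ, bᵢ]` of complexity `m` (witnessed by pairwise
disjoint sets `Eᵢ ⊆ R̃ᵢ` with `|Eᵢ| ≥ ½|R̃ᵢ|`),
`∑ᵢ U(R̃ᵢ) (⨍_{R̃ᵢ} |f|)^p ≤ C ∫ |f|^p 𝔐ₘU dx`. -/
theorem sparse_rectangles_carleson_bound
    (d m : ℕ) (hd : 1 ≤ d) (hm : 1 ≤ m) (hmd : m ≤ d) (p : ℝ) (hp : 1 < p) :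
    ∃ C : ℝ, 0 < C ∧
      ∀ (U : (Fin d → ℝ) → ℝ), (∀ x, 0 ≤ U x) → LocallyIntegrable U →
      ∀ (N : ℕ) (a b : Fin N → Fin d → ℝ),
        (∀ i l, a i l < b i l) →
        (∀ i, (Finset.image (fun l => b i l - a i l) Finset.univ).card ≤ m) →
      ∀ (E : Fin N → Set (Fin d → ℝ)),
        (∀ i, MeasurableSet (E i)) →
        Pairwise (Function.onFun Disjoint E) →
        (∀ i, E i ⊆ Set.Icc (a i) (b i)) →
        (∀ i, volume (Set.Icc (a i) (b i)) ≤ 2 * volume (E i)) →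
      ∀ f : (Fin d → ℝ) → ℝ, LocallyIntegrable f →
        ∑ i, (∫⁻ y in Set.Icc (a i) (b i), ENNReal.ofReal (U y)) *
            ((∫⁻ y in Set.Icc (a i) (b i), ENNReal.ofReal |f y|) /
              volume (Set.Icc (a i) (b i))) ^ p
          ≤ ENNReal.ofReal C *
            ∫⁻ x, ENNReal.ofReal |f x| ^ p *
              strongMaximal d m (fun y => ENNReal.ofReal (U y)) x := by
  have hp0 : 0 < p := by linarith
  set K : ℝ := p * 10 * (2 ^ (p - 1) / (p - 1)) with hK
  have hKpos : 0 < K := by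
    have : 0 < p - 1 := by linarith
    positivity
  refine ⟨2 * K ^ d, by positivity, ?_⟩
  intro U _ _ N a b hab hcard E hE hdisj hsub hvol f hf
  have hvpos (i : Fin N) : volume (Set.Icc (a i) (b i)) ≠ 0 := by
    rw [Real.volume_Icc_pi]
    simp [Finset.prod_eq_zero_iff, hab]
  have hvtop (i : Fin N) : volume (Set.Icc (a i) (b i)) ≠ ⊤ := isCompact_Icc.measure_ne_top
  have hfm : AEMeasurable (fun y => ENNReal.ofReal |f y|) volume :=
    hf.aestronglyMeasurable.aemeasurable.abs.ennreal_ofReal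
  set u : Fin N → ℝ≥0∞ := fun i =>
    (∫⁻ y in Set.Icc (a i) (b i), ENNReal.ofReal (U y)) / volume (Set.Icc (a i) (b i)) with hu
  set V : (Fin d → ℝ) → ℝ≥0∞ := fun x => ⨆ i, (Set.Icc (a i) (b i)).indicator (fun _ => u i) x
  have hVm : Measurable V := .iSup fun _ => measurable_const.indicator measurableSet_Icc
  have hV (x) : V x ≤ strongMaximal d m (fun y => ENNReal.ofReal (U y)) x := by
    refine iSup_le fun i => Set.indicator_apply_le' (fun hx => ?_) (fun _ => zero_le)
    exact le_iSup_of_le (a i) <| le_iSup_of_le (b i) <| le_iSup_of_le (hab i) <|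
      le_iSup_of_le (hcard i) <| le_iSup_of_le hx le_rfl
  have huV (i) (x) (hx : x ∈ Set.Icc (a i) (b i)) : u i ≤ V x := by
    refine le_iSup_of_le i ?_
    rw [Set.indicator_of_mem hx]
  set g : (Fin d → ℝ) → ℝ≥0∞ := fun x => V x ^ p⁻¹ * hfm.mk _ x with hg
  have hgm : Measurable g := (hVm.pow_const _).mul hfm.measurable_mk
  have hpow (y z : ℝ≥0∞) : (y ^ p⁻¹ * z) ^ p = y * z ^ p := by
    rw [ENNReal.mul_rpow_of_nonneg _ _ hp0.le, ENNReal.rpow_inv_rpow hp0.ne']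
  calc ∑ i, (∫⁻ y in Set.Icc (a i) (b i), ENNReal.ofReal (U y)) *
          ((∫⁻ y in Set.Icc (a i) (b i), ENNReal.ofReal |f y|) /
            volume (Set.Icc (a i) (b i))) ^ p
      ≤ ∑ i, volume (Set.Icc (a i) (b i)) *
          ((∫⁻ y in Set.Icc (a i) (b i), g y) / volume (Set.Icc (a i) (b i))) ^ p := by
        refine Finset.sum_le_sum fun i _ => ?_
        rw [← ENNReal.mul_div_cancel (a := volume (Set.Icc (a i) (b i)))
          (b := ∫⁻ y in Set.Icc (a i) (b i), ENNReal.ofReal (U y)) (hvpos i) (hvtop i), mul_assoc]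
        refine mul_le_mul_right ?_ _
        rw [← hpow, ← mul_div_assoc]
        gcongr
        rw [← lintegral_const_mul'' _ hfm.restrict]
        refine lintegral_mono_ae ?_
        filter_upwards [ae_restrict_mem measurableSet_Icc, ae_restrict_of_ae hfm.ae_eq_mk]
          with x hx hfx
        rw [hfx]
        refine mul_le_mul_left ?_ _
        exact ENNReal.rpow_le_rpow (huV i x hx) (by positivity)
    _ ≤ 2 * ENNReal.ofReal K ^ d * ∫⁻ x, g x ^ p := by
        simpa using sum_volume_mul_average_rpow_le hab hp hE hdisj hsub hvol hgm
    _ ≤ _ := by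
        rw [ENNReal.ofReal_mul zero_le_two, ENNReal.ofReal_ofNat, ENNReal.ofReal_pow hKpos.le]
        gcongr 2 * _ * ?_
        refine lintegral_mono_ae ?_
        filter_upwards [hfm.ae_eq_mk] with x hfx
        rw [hfx, hg, hpow, mul_comm]
        gcongr
        exact hV x
end
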